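/- For every 1 < p < 2 there exist x, y ∈ ℓ¹(ℤ) such that the zero sets of x̂ and ŷ on the circle coincide, x is cyclic in ℓ^p(ℤ), and y is not cyclic in ℓ^p(ℤ). -/

import Mathlib

open Complex

/-- `x` is a cyclic vector in `ℓᵖ(ℤ)`: the closed linear span of the translates
`(x_{k-m})_k`, `m ∈ ℤ`, is all of `ℓᵖ(ℤ)`. -/
def IsCyclicVector (p : ENNReal) [Fact (1 ≤ p)] (x : ℤ → ℂ) : Prop :=
  Dense (↑(Submodule.span ℂ
    {y : lp (fun _ : ℤ => ℂ) p | ∃ m : ℤ, ∀ k : ℤ, (y : ℤ → ℂ) k = x (k - m)}) :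
    Set (lp (fun _ : ℤ => ℂ) p))

namespace LevOlevskii

open Filter Topology MeasureTheory

/-- The space `ℓᵖ(ℤ)` of complex sequences. -/
noncomputable abbrev Seq (p : ENNReal) := lp (fun _ : ℤ => ℂ) p

theorem memℓp_comp_equiv {p : ENNReal} {v : ℤ → ℂ} (hv : Memℓp v p) (e : ℤ ≃ ℤ) :
    Memℓp (fun k => v (e k)) p := by
  rcases p.trichotomy with rfl | rfl | hp
  · apply memℓp_zero
    exact (memℓp_zero_iff.1 hv).preimage (f := e) e.injective.injOn
  · apply memℓp_infty
    have := memℓp_infty_iff.1 hv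
    refine this.mono ?_
    rintro _ ⟨k, rfl⟩
    exact ⟨e k, rfl⟩
  · apply memℓp_gen
    exact (e.summable_iff (f := fun k => ‖v k‖ ^ p.toReal)).2 (hv.summable hp)

theorem norm_comp_equiv {p : ENNReal} (v w : Seq p) (e : ℤ ≃ ℤ) (h : ∀ k, w k = v (e k)) :
    ‖w‖ = ‖v‖ := by
  rcases p.trichotomy with rfl | rfl | hp
  · rw [lp.norm_eq_card_dsupport, lp.norm_eq_card_dsupport]
    norm_cast
    apply Finset.card_bij (fun k _ => e k)
    · intro k hk
      simpa [h] using hk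
    · intro a _ b _ hab
      exact e.injective hab
    · intro b hb
      exact ⟨e.symm b, by simpa [h] using hb, by simp⟩
  · rw [lp.norm_eq_ciSup, lp.norm_eq_ciSup]
    simp only [h]
    exact e.iSup_comp (g := fun k => ‖v k‖)
  · rw [lp.norm_eq_tsum_rpow hp, lp.norm_eq_tsum_rpow hp]
    simp only [h]
    rw [e.tsum_eq (fun k => ‖v k‖ ^ p.toReal)]

/-- Translation by `m` on `ℓᵖ(ℤ)`. -/
noncomputable def shift (p : ENNReal) [Fact (1 ≤ p)] (m : ℤ) : Seq p →L[ℂ] Seq p :=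
  LinearIsometry.toContinuousLinearMap
    { toFun := fun v => ⟨fun k => v (k - m), memℓp_comp_equiv v.2 (Equiv.subRight m)⟩
      map_add' := fun _ _ => rfl
      map_smul' := fun _ _ => rfl
      norm_map' := fun v => norm_comp_equiv v _ (Equiv.subRight m) fun _ => rfl }

/-- The standard basis vectors of `ℓᵖ(ℤ)`. -/
noncomputable def e (p : ENNReal) (m : ℤ) : Seq p := lp.single p m (1 : ℂ)

theorem e_apply {p : ENNReal} (m k : ℤ) : e p m k = if k = m then 1 else 0 := by
  rw [e, lp.single_apply]
  by_cases h : k = m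
  · subst h; simp
  · simp [h]

theorem smul_e {p : ENNReal} (m : ℤ) (a : ℂ) : a • e p m = lp.single p m a := by
  rw [e, ← lp.single_smul]; simp

variable {p : ENNReal} [Fact (1 ≤ p)]

@[simp] theorem shift_apply (m : ℤ) (v : Seq p) (k : ℤ) : shift p m v k = v (k - m) := rfl

@[simp] theorem norm_shift (m : ℤ) (v : Seq p) : ‖shift p m v‖ = ‖v‖ :=
  norm_comp_equiv v _ (Equiv.subRight m) fun _ => rfl

theorem shift_shift (m n : ℤ) (v : Seq p) : shift p m (shift p n v) = shift p (m + n) v := by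
  ext k
  simp only [shift_apply]
  rw [sub_sub]

theorem shift_zero (v : Seq p) : shift p 0 v = v := by
  ext k
  simp

theorem norm_e (m : ℤ) : ‖e p m‖ = 1 := by
  rw [e, lp.norm_single (lt_of_lt_of_le one_pos Fact.out)]
  simp

theorem shift_e (m n : ℤ) : shift p m (e p n) = e p (m + n) := by
  ext k
  rw [shift_apply, e_apply, e_apply]
  congr 1
  rw [eq_iff_iff]
  omega

theorem eq_top_of_forall_e_mem (hp : p ≠ ⊤) (R : Submodule ℂ (Seq p))
    (hR : IsClosed (R : Set (Seq p))) (h : ∀ m, e p m ∈ R) : R = ⊤ := by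
  rw [eq_top_iff]
  rintro v -
  have hs := lp.hasSum_single hp v
  refine hR.mem_of_tendsto hs (Eventually.of_forall fun s => ?_)
  refine R.sum_mem fun k _ => ?_
  rw [← smul_e]
  exact R.smul_mem _ (h k)

theorem denseRange_of_forall_e_mem (hp : p ≠ ⊤) (T : Seq p →L[ℂ] Seq p)
    (h : ∀ m, e p m ∈ (LinearMap.range T.toLinearMap).topologicalClosure) : DenseRange T := by
  have := eq_top_of_forall_e_mem hp _
    (LinearMap.range T.toLinearMap).isClosed_topologicalClosure h
  have h2 := Submodule.dense_iff_topologicalClosure_eq_top.2 this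
  exact h2

theorem norm_sum_smul_e_le (hp : p ≠ ⊤) (m : ℤ) (c : ℕ → ℂ) (hc : ∀ j, ‖c j‖ ≤ 1) (n : ℕ) :
    ‖∑ j ∈ Finset.range n, c j • e p (m + j)‖ ≤ (n : ℝ) ^ (1 / p.toReal) := by
  have hp0 : 0 < p.toReal :=
    ENNReal.toReal_pos (lt_of_lt_of_le one_pos (Fact.out : 1 ≤ p)).ne' hp
  set v : ℤ → ℂ := fun k => c (k - m).toNat
  have h1 : ∑ j ∈ Finset.range n, c j • e p (m + j) =
      ∑ k ∈ (Finset.range n).map ⟨fun j : ℕ => m + (j : ℤ), fun a b h => by simpa using h⟩,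
        lp.single p k (v k) := by
    rw [Finset.sum_map]
    refine Finset.sum_congr rfl fun j _ => ?_
    rw [smul_e]
    change _ = lp.single (E := fun _ : ℤ => ℂ) p (m + (j : ℤ)) (c (m + (j : ℤ) - m).toNat)
    rw [add_sub_cancel_left, Int.toNat_natCast]
  have h2 := lp.norm_sum_single hp0 v
    ((Finset.range n).map ⟨fun j : ℕ => m + (j : ℤ), fun a b h => by simpa using h⟩)
  rw [← h1] at h2
  have h3 : ‖∑ j ∈ Finset.range n, c j • e p (m + j)‖ ^ p.toReal ≤ n := by
    rw [h2]
    refine (Finset.sum_le_card_nsmul _ _ 1 fun k _ => ?_).trans ?_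
    · exact Real.rpow_le_one (norm_nonneg _) (hc _) hp0.le
    · simp
  rw [one_div]
  exact (Real.le_rpow_inv_iff_of_pos (norm_nonneg _) (by positivity) hp0).2 h3

theorem denseRange_shift_sub (hp1 : 1 < p) (hp : p ≠ ⊤) (ζ : ℂ) :
    DenseRange (shift p 1 - algebraMap ℂ (Seq p →L[ℂ] Seq p) ζ) := by
  have hp1' : 1 < p.toReal := by
    rw [← ENNReal.toReal_one]; exact (ENNReal.toReal_lt_toReal (by simp) hp).2 hp1
  apply denseRange_of_forall_e_mem hp
  intro m
  set T := shift p 1 - algebraMap ℂ (Seq p →L[ℂ] Seq p) ζ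
  have hT : ∀ k, T (e p k) = e p (k + 1) - ζ • e p k := by
    intro k
    change shift p 1 (e p k) - _ = _
    rw [shift_e, add_comm]
    congr 1
  set R := LinearMap.range T.toLinearMap
  have hm : ∀ k, e p (k + 1) - ζ • e p k ∈ R := fun k => ⟨e p k, hT k⟩
  by_cases hζ : ‖ζ‖ < 1
  · have hind : ∀ j : ℕ, e p m - ζ ^ j • e p (m - j) ∈ R := by
      intro j
      induction j with
      | zero => simp
      | succ j ih =>
        have h := R.smul_mem (ζ ^ j) (hm (m - (j + 1)))
        have := R.add_mem ih h
        convert this using 1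
        rw [show m - ((j : ℤ) + 1) + 1 = m - j by ring, smul_sub, smul_smul, ← pow_succ]
        push_cast
        abel
    have hlim : Tendsto (fun j : ℕ => e p m - ζ ^ j • e p (m - j)) atTop (𝓝 (e p m - 0)) := by
      refine tendsto_const_nhds.sub ?_
      rw [tendsto_zero_iff_norm_tendsto_zero]
      simp only [norm_smul, norm_e, mul_one, norm_pow]
      exact tendsto_pow_atTop_nhds_zero_of_lt_one (norm_nonneg _) hζ
    rw [sub_zero] at hlim
    exact mem_closure_of_tendsto hlim (Eventually.of_forall hind)
  · push Not at hζ
    have hζ0 : ζ ≠ 0 := by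
      rintro rfl; simp at hζ; linarith
    have hind : ∀ j : ℕ, e p m - (ζ⁻¹) ^ j • e p (m + j) ∈ R := by
      intro j
      induction j with
      | zero => simp
      | succ j ih =>
        have h := R.smul_mem ((ζ⁻¹) ^ (j + 1)) (hm (m + j))
        have := R.sub_mem ih h
        convert this using 1
        rw [smul_sub, smul_smul, pow_succ, mul_assoc, inv_mul_cancel₀ hζ0, mul_one]
        push_cast
        rw [add_assoc]
        abel
    have hlim : Tendsto (fun n : ℕ => ((n : ℂ) + 1)⁻¹ • ∑ j ∈ Finset.range (n + 1),
        (e p m - (ζ⁻¹) ^ j • e p (m + j))) atTop (𝓝 (e p m - 0)) := by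
      have heq : ∀ n : ℕ, ((n : ℂ) + 1)⁻¹ • ∑ j ∈ Finset.range (n + 1),
          (e p m - (ζ⁻¹) ^ j • e p (m + j)) =
          e p m - ((n : ℂ) + 1)⁻¹ • ∑ j ∈ Finset.range (n + 1), (ζ⁻¹) ^ j • e p (m + j) := by
        intro n
        rw [Finset.sum_sub_distrib, smul_sub, Finset.sum_const, Finset.card_range,
          ← Nat.cast_smul_eq_nsmul ℂ, smul_smul]
        push_cast
        rw [inv_mul_cancel₀ (Nat.cast_add_one_ne_zero n), one_smul]
      simp only [heq]
      refine tendsto_const_nhds.sub ?_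
      have hb : Tendsto (fun n : ℕ => ((n + 1 : ℕ) : ℝ) ^ (-(1 - 1 / p.toReal))) atTop (𝓝 0) := by
        refine ((tendsto_rpow_neg_atTop ?_).comp tendsto_natCast_atTop_atTop).comp
          (tendsto_add_atTop_nat 1)
        rw [sub_pos, div_lt_one (by linarith)]
        exact hp1'
      refine squeeze_zero_norm (fun n => ?_) hb
      rw [norm_smul]
      have h1 := norm_sum_smul_e_le hp m (fun j => (ζ⁻¹) ^ j) (fun j => by
        rw [norm_pow, norm_inv]
        exact pow_le_one₀ (by positivity) (inv_le_one_of_one_le₀ hζ)) (n + 1)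
      have h2 : ‖((n : ℂ) + 1)⁻¹‖ = ((n + 1 : ℕ) : ℝ) ^ (-1 : ℝ) := by
        rw [norm_inv, Real.rpow_neg_one]
        congr 1
        exact_mod_cast Complex.norm_natCast (n + 1)
      rw [h2, show -(1 - 1 / p.toReal) = -1 + 1 / p.toReal by ring,
        Real.rpow_add (by positivity)]
      gcongr
    rw [sub_zero] at hlim
    exact mem_closure_of_tendsto hlim (Eventually.of_forall fun n =>
      R.smul_mem _ (R.sum_mem fun j _ => hind j))

theorem denseRange_aeval_shift (hp1 : 1 < p) (hp : p ≠ ⊤) (P : Polynomial ℂ) (hP : P ≠ 0) :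
    DenseRange (Polynomial.aeval (shift p 1) P) := by
  have hs := IsAlgClosed.splits P
  rw [hs.eq_prod_roots]
  have hc : P.leadingCoeff ≠ 0 := by simpa using hP
  have hroots : ∀ s : Multiset ℂ, DenseRange (Polynomial.aeval (shift p 1)
      (s.map fun a => Polynomial.X - Polynomial.C a).prod) := by
    intro s
    induction s using Multiset.induction with
    | empty => simpa using Function.surjective_id.denseRange
    | cons a s ih =>
      rw [Multiset.map_cons, Multiset.prod_cons, map_mul]
      have := denseRange_shift_sub hp1 hp a
      rw [map_sub, Polynomial.aeval_X, Polynomial.aeval_C]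
      exact this.comp ih (ContinuousLinearMap.continuous _)
  rw [map_mul, Polynomial.aeval_C]
  refine DenseRange.comp (g := algebraMap ℂ (Seq p →L[ℂ] Seq p) P.leadingCoeff) ?_ (hroots _)
    (ContinuousLinearMap.continuous _)
  refine Function.Surjective.denseRange fun v => ⟨P.leadingCoeff⁻¹ • v, ?_⟩
  change P.leadingCoeff • (P.leadingCoeff⁻¹ • v) = v
  rw [smul_smul, mul_inv_cancel₀ hc, one_smul]

/-- The span of all translates of a vector. -/
noncomputable def translates (v : Seq p) : Submodule ℂ (Seq p) :=
  Submodule.span ℂ (Set.range fun m : ℤ => shift p m v)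

theorem shift_pow (n : ℕ) : (shift p 1) ^ n = shift p n := by
  induction n with
  | zero => ext v k; simp
  | succ n ih =>
    ext1 v
    rw [pow_succ, ih]
    change shift p n (shift p 1 v) = _
    rw [shift_shift]
    push_cast
    rfl

/-- The embedding of finitely supported sequences into `ℓᵖ(ℤ)`. -/
noncomputable def emb (p : ENNReal) [Fact (1 ≤ p)] : (ℤ →₀ ℂ) →ₗ[ℂ] Seq p :=
  Finsupp.linearCombination ℂ (e p)

theorem emb_single (m : ℤ) (a : ℂ) : emb p (Finsupp.single m a) = a • e p m := by
  simp [emb]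

@[simp] theorem emb_apply (f : ℤ →₀ ℂ) (k : ℤ) : emb p f k = f k := by
  induction f using Finsupp.induction_linear with
  | zero => simp
  | add f g hf hg => rw [map_add, lp.coeFn_add, Pi.add_apply, hf, hg]; rfl
  | single m a =>
    rw [emb_single, lp.coeFn_smul, Pi.smul_apply, e_apply, Finsupp.single_apply]
    by_cases h : k = m
    · simp [h]
    · simp [h, Ne.symm h]

theorem exists_polynomial (f : ℤ →₀ ℂ) : ∃ (n : ℕ) (P : Polynomial ℂ),
    shift p n (emb p f) = Polynomial.aeval (shift p 1) P (e p 0) := by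
  have hX : ∀ (n : ℕ) (P : Polynomial ℂ), Polynomial.aeval (shift p 1) (Polynomial.X ^ n * P) (e p 0)
      = shift p n (Polynomial.aeval (shift p 1) P (e p 0)) := by
    intro n P
    rw [map_mul, map_pow, Polynomial.aeval_X, shift_pow]
    rfl
  induction f using Finsupp.induction_linear with
  | zero => exact ⟨0, 0, by simp⟩
  | add f g hf hg =>
    obtain ⟨n, P, hf⟩ := hf
    obtain ⟨m, Q, hg⟩ := hg
    refine ⟨m + n, Polynomial.X ^ m * P + Polynomial.X ^ n * Q, ?_⟩
    rw [map_add (Polynomial.aeval (shift p 1)), _root_.add_apply, hX, hX, ← hf, ← hg,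
      shift_shift, shift_shift, map_add, map_add]
    push_cast
    rw [add_comm (n : ℤ) m]
  | single m a =>
    refine ⟨m.natAbs, Polynomial.X ^ (m + m.natAbs).toNat * Polynomial.C a, ?_⟩
    rw [hX, emb_single, Polynomial.aeval_C]
    change _ = shift p _ (a • e p 0)
    rw [map_smul, map_smul, shift_e, shift_e]
    congr 2
    omega

theorem translates_emb_topologicalClosure (hp1 : 1 < p) (hp : p ≠ ⊤) (f : ℤ →₀ ℂ) (hf : f ≠ 0) :
    (translates (emb p f)).topologicalClosure = ⊤ := by
  obtain ⟨n, P, h⟩ := exists_polynomial (p := p) f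
  have hP : P ≠ 0 := by
    rintro rfl
    apply hf
    ext k
    have := congrArg (fun v : Seq p => v (k + n)) h
    simpa using this
  set R := (translates (emb p f)).topologicalClosure
  have hcl : IsClosed (R : Set (Seq p)) := Submodule.isClosed_topologicalClosure _
  have hcomm : ∀ (m : ℤ) (v : Seq p), Polynomial.aeval (shift p 1) P (shift p m v) =
      shift p m (Polynomial.aeval (shift p 1) P v) := by
    intro m v
    rw [Polynomial.aeval_eq_sum_range]
    simp only [_root_.sum_apply, _root_.smul_apply, map_sum, map_smul,
      shift_pow, shift_shift, add_comm]
  have hpre : R.comap (Polynomial.aeval (shift p 1) P).toLinearMap = ⊤ := by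
    apply eq_top_of_forall_e_mem hp
    · exact hcl.preimage (Polynomial.aeval (shift p 1) P).continuous
    · intro m
      change Polynomial.aeval (shift p 1) P (e p m) ∈ R
      have := hcomm m (e p 0)
      rw [shift_e, add_zero] at this
      rw [this, ← h, shift_shift]
      exact Submodule.le_topologicalClosure _ (Submodule.subset_span ⟨_, rfl⟩)
  rw [eq_top_iff]
  rintro v -
  have hd := denseRange_aeval_shift hp1 hp P hP v
  refine closure_minimal ?_ hcl hd
  rintro _ ⟨w, rfl⟩
  have : w ∈ R.comap (Polynomial.aeval (shift p 1) P).toLinearMap := by rw [hpre]; trivial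
  exact this

/-- The vectors some combination of whose translates is `ε`-close to `e₀`. -/
def nearCyclic (p : ENNReal) [Fact (1 ≤ p)] (ε : ℝ) : Set (Seq p) :=
  {x | ∃ v ∈ translates x, ‖v - e p 0‖ < ε}

theorem isOpen_nearCyclic (ε : ℝ) : IsOpen (nearCyclic p ε) := by
  have : nearCyclic p ε = ⋃ c : ℤ →₀ ℂ,
      {x | ‖(c.sum fun m a => a • shift p m x) - e p 0‖ < ε} := by
    ext x
    simp only [nearCyclic, translates, Set.mem_ofPred_eq, Set.mem_iUnion]
    constructor
    · rintro ⟨v, hv, h⟩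
      obtain ⟨c, rfl⟩ := Finsupp.mem_span_range_iff_exists_finsupp.1 hv
      exact ⟨c, h⟩
    · rintro ⟨c, h⟩
      exact ⟨_, Finsupp.mem_span_range_iff_exists_finsupp.2 ⟨c, rfl⟩, h⟩
  rw [this]
  refine isOpen_iUnion fun c => isOpen_lt (Continuous.norm (Continuous.sub ?_ continuous_const))
    continuous_const
  unfold Finsupp.sum
  fun_prop

theorem emb_mem_nearCyclic (hp1 : 1 < p) (hp : p ≠ ⊤) (f : ℤ →₀ ℂ) (hf : f ≠ 0) {ε : ℝ}
    (hε : 0 < ε) : emb p f ∈ nearCyclic p ε := by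
  have h : e p 0 ∈ (translates (emb p f)).topologicalClosure := by
    rw [translates_emb_topologicalClosure hp1 hp f hf]; trivial
  obtain ⟨v, hv, h⟩ := Metric.mem_closure_iff.1 h ε hε
  exact ⟨v, hv, by rwa [dist_comm, dist_eq_norm] at h⟩

theorem topologicalClosure_translates_of_nearCyclic (hp : p ≠ ⊤) (x : Seq p)
    (h : ∀ n : ℕ, x ∈ nearCyclic p (1 / ((n : ℝ) + 1))) :
    (translates x).topologicalClosure = ⊤ := by
  have h0 : e p 0 ∈ (translates x).topologicalClosure := by
    refine Metric.mem_closure_iff.2 fun ε hε => ?_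
    obtain ⟨n, hn⟩ := exists_nat_one_div_lt hε
    obtain ⟨v, hv, h⟩ := h n
    exact ⟨v, hv, by rw [dist_comm, dist_eq_norm]; exact h.trans hn⟩
  apply eq_top_of_forall_e_mem hp _ (Submodule.isClosed_topologicalClosure _)
  intro m
  have hle : (translates x).topologicalClosure ≤
      (translates x).topologicalClosure.comap (shift p m).toLinearMap := by
    apply Submodule.topologicalClosure_minimal
    · refine Submodule.span_le.2 ?_
      rintro _ ⟨n, rfl⟩
      apply Submodule.le_topologicalClosure
      change shift p m (shift p n x) ∈ _
      rw [shift_shift]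
      exact Submodule.subset_span ⟨_, rfl⟩
    · exact (Submodule.isClosed_topologicalClosure _).preimage (shift p m).continuous
  have : shift p m (e p 0) ∈ (translates x).topologicalClosure := hle h0
  rwa [shift_e, add_zero] at this

theorem span_translates_eq (x : ℤ → ℂ) (v : Seq p) (h : ∀ k, v k = x k) :
    Submodule.span ℂ {y : Seq p | ∃ m : ℤ, ∀ k : ℤ, (y : ℤ → ℂ) k = x (k - m)} =
      translates v := by
  unfold translates
  congr 1
  ext y
  constructor
  · rintro ⟨m, hm⟩
    exact ⟨m, by ext k; simp [h, hm]⟩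
  · rintro ⟨m, rfl⟩
    exact ⟨m, fun k => by simp [h]⟩

theorem norm_le_of_le_exponent {p q : ENNReal} [Fact (1 ≤ p)] [Fact (1 ≤ q)] (hpq : p ≤ q)
    (hq : q ≠ ⊤) (v : Seq p) (w : Seq q) (h : ∀ k, w k = v k) : ‖w‖ ≤ ‖v‖ := by
  have hp : p ≠ ⊤ := ne_top_of_le_ne_top hq hpq
  have hp0 : 0 < p.toReal :=
    ENNReal.toReal_pos (lt_of_lt_of_le one_pos (Fact.out : 1 ≤ p)).ne' hp
  have hpq' : p.toReal ≤ q.toReal := ENNReal.toReal_mono hq hpq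
  refine lp.norm_le_of_forall_sum_le (hp0.trans_le hpq') (norm_nonneg _) fun s => ?_
  have h1 : ∀ k ∈ s, ‖w k‖ ^ q.toReal ≤ ‖v‖ ^ (q.toReal - p.toReal) * ‖v k‖ ^ p.toReal := by
    intro k _
    rw [h, show q.toReal = (q.toReal - p.toReal) + p.toReal by ring,
      Real.rpow_add_of_nonneg (norm_nonneg _) (by linarith) hp0.le, add_sub_cancel_right]
    refine mul_le_mul_of_nonneg_right (Real.rpow_le_rpow (norm_nonneg _) ?_ (by linarith))
      (by positivity)
    exact lp.norm_apply_le_norm (lt_of_lt_of_le one_pos (Fact.out : 1 ≤ p)).ne' v k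
  refine (Finset.sum_le_sum h1).trans ?_
  rw [← Finset.mul_sum]
  have h2 := lp.sum_rpow_le_norm_rpow hp0 v s
  calc _ ≤ ‖v‖ ^ (q.toReal - p.toReal) * ‖v‖ ^ p.toReal := by gcongr
    _ = _ := by
      rw [← Real.rpow_add_of_nonneg (norm_nonneg _) (by linarith) hp0.le]
      congr 1
      ring

/-- The circle `ℝ / 2πℤ`. -/
noncomputable abbrev Circ := AddCircle (2 * Real.pi)

theorem fact_two_pi_pos : Fact (0 < 2 * Real.pi) := ⟨Real.two_pi_pos⟩

attribute [local instance] fact_two_pi_pos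

/-- Normalised Haar measure on the circle. -/
noncomputable abbrev haar : Measure Circ := AddCircle.haarAddCircle

open Classical in
/-- The sequence of Fourier coefficients of a square integrable function, in `ℓ^q(ℤ)`. -/
noncomputable def fc (q : ENNReal) [hq : Fact (2 ≤ q)] (f : Circ → ℂ) : Seq q :=
  if h : MemLp f 2 haar then
    lp.linearMapOfLE ℂ (fun _ : ℤ => ℂ) hq.out (fourierBasis.repr (h.toLp f)) else 0

section
variable {q : ENNReal} [Fact (2 ≤ q)]

theorem fc_apply {f : Circ → ℂ} (h : MemLp f 2 haar) (k : ℤ) : fc q f k = fourierCoeff f k := by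
  rw [fc, dif_pos h, lp.coe_linearMapOfLE_apply, fourierBasis_repr]
  exact congrFun (fourierCoeff_congr_ae (MemLp.coeFn_toLp h)) k

theorem fc_add {f g : Circ → ℂ} (hf : MemLp f 2 haar) (hg : MemLp g 2 haar) :
    fc q (fun t => f t + g t) = fc q f + fc q g := by
  ext k
  rw [lp.coeFn_add, Pi.add_apply, fc_apply hf, fc_apply hg]
  refine (fc_apply (hf.add hg) k).trans ?_
  exact congrFun (fourierCoeff.add (hf.integrable one_le_two) (hg.integrable one_le_two)) k

theorem fc_const_mul {f : Circ → ℂ} (hf : MemLp f 2 haar) (c : ℂ) :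
    fc q (fun t => c * f t) = c • fc q f := by
  ext k
  rw [lp.coeFn_smul, Pi.smul_apply, fc_apply hf, fc_apply (hf.const_mul c)]
  exact fourierCoeff.const_mul f c k

theorem fc_sub {f g : Circ → ℂ} (hf : MemLp f 2 haar) (hg : MemLp g 2 haar) :
    fc q (fun t => f t - g t) = fc q f - fc q g := by
  have := fc_add (q := q) hf (hg.const_mul (-1))
  rw [fc_const_mul hg] at this
  simpa [sub_eq_add_neg] using this

theorem fc_sum {ι : Type*} (s : Finset ι) (f : ι → Circ → ℂ) (hf : ∀ i ∈ s, MemLp (f i) 2 haar) :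
    fc q (fun t => ∑ i ∈ s, f i t) = ∑ i ∈ s, fc q (f i) := by
  classical
  induction s using Finset.induction_on with
  | empty =>
    have := fc_const_mul (q := q) (f := fun _ => 0) (memLp_const 0) 0
    simpa using this
  | insert i s hi ih =>
    simp only [Finset.sum_insert hi]
    rw [fc_add (hf i (by simp)) (memLp_finsetSum s fun j hj => hf j (by simp [hj])),
      ih fun j hj => hf j (by simp [hj])]

theorem fc_fourier_mul [Fact (1 ≤ q)] {f : Circ → ℂ} (hf : MemLp f 2 haar) (n : ℤ) :
    fc q (fun t => fourier n t * f t) = shift q n (fc q f) := by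
  have h : MemLp (fun t => fourier n t * f t) 2 haar := by
    refine hf.of_le_mul (c := 1) ?_ ?_
    · exact ((fourier n).continuous.aestronglyMeasurable).mul hf.1
    · refine Eventually.of_forall fun t => ?_
      rw [norm_mul, fourier_apply, Circle.norm_coe]
  ext k
  rw [fc_apply h, shift_apply, fc_apply hf]
  unfold fourierCoeff
  congr 1
  ext t
  rw [smul_eq_mul, smul_eq_mul, ← mul_assoc, ← fourier_add]
  congr 3
  ring

theorem norm_fc_sq_le [Fact (1 ≤ q)] (hq : q ≠ ⊤) {f : Circ → ℂ} (hf : MemLp f 2 haar) :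
    ‖fc q f‖ ^ 2 ≤ ∫ t, ‖f t‖ ^ 2 ∂haar := by
  have h1 : ‖fc q f‖ ≤ ‖fourierBasis.repr (hf.toLp f)‖ := by
    apply norm_le_of_le_exponent Fact.out hq
    intro k
    rw [fc, dif_pos hf, lp.coe_linearMapOfLE_apply]
  have h2 := hasSum_sq_fourierCoeff (hf.toLp f)
  have h3 : HasSum (fun i => ‖fourierBasis.repr (hf.toLp f) i‖ ^ (2 : ENNReal).toReal)
      (‖fourierBasis.repr (hf.toLp f)‖ ^ (2 : ENNReal).toReal) := lp.hasSum_norm (by simp) _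
  simp only [ENNReal.toReal_ofNat, fourierBasis_repr, Real.rpow_two] at h3
  have h4 := h3.unique h2
  calc ‖fc q f‖ ^ 2 ≤ ‖fourierBasis.repr (hf.toLp f)‖ ^ 2 := by gcongr
    _ = _ := h4
    _ = _ := by
      apply integral_congr_ae
      filter_upwards [MemLp.coeFn_toLp hf] with t ht
      rw [ht]

theorem norm_fc_le_of_bound [Fact (1 ≤ q)] (hq : q ≠ ⊤) {f : Circ → ℂ} (hf : MemLp f 2 haar)
    {β : ℝ} (hβ : 0 ≤ β) (h : ∀ t, ‖f t‖ ≤ β) : ‖fc q f‖ ≤ β := by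
  have h1 := norm_fc_sq_le (q := q) hq hf
  have h2 : ∫ t, ‖f t‖ ^ 2 ∂haar ≤ ∫ _t, β ^ 2 ∂haar := by
    apply integral_mono_of_nonneg (Eventually.of_forall fun t => by positivity)
      (integrable_const _)
    refine Eventually.of_forall fun t => ?_
    have := h t
    dsimp only
    gcongr
  rw [integral_const, probReal_univ, one_smul] at h2
  exact abs_le_of_sq_le_sq' (h1.trans h2) hβ |>.2

end

theorem memLp_of_bound {f : Circ → ℂ} (hf : Measurable f) {β : ℝ} (h : ∀ t, ‖f t‖ ≤ β) :
    MemLp f 2 haar := MemLp.of_bound hf.aestronglyMeasurable β (Eventually.of_forall h)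

theorem tendsto_integral_fourier_mul {f : Circ → ℂ} (hf : MemLp f 2 haar) {m : ℤ} (hm : m ≠ 0) :
    Tendsto (fun r : ℕ => ∫ t, f t * fourier (r * m) t ∂haar) atTop (𝓝 0) := by
  have h2 := (hasSum_sq_fourierCoeff (hf.toLp f)).summable.tendsto_cofinite_zero
  have hinj : Function.Injective fun r : ℕ => -((r : ℤ) * m) := by
    intro a b hab
    have : (a : ℤ) * m = b * m := neg_injective hab
    exact_mod_cast mul_right_cancel₀ hm this
  have h3 := h2.comp (hinj.tendsto_cofinite)
  rw [Nat.cofinite_eq_atTop] at h3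
  have h4 : Tendsto (fun r : ℕ => ‖fourierCoeff (hf.toLp f) (-((r : ℤ) * m))‖) atTop (𝓝 0) := by
    have := h3.sqrt
    simpa using this
  rw [tendsto_zero_iff_norm_tendsto_zero]
  refine h4.congr fun r => ?_
  rw [fourierCoeff_congr_ae (MemLp.coeFn_toLp hf)]
  unfold fourierCoeff
  simp only [neg_neg, smul_eq_mul, mul_comm]

/-- Far translates of finitely many vectors behave as if disjointly supported. -/
theorem eventually_norm_sum_shift_le {q : ENNReal} [Fact (1 ≤ q)] (hq : q ≠ ⊤) {ι : Type*}
    (I : Finset ι) (K : ι → ℤ) (hK : Set.InjOn K I) (v : ι → Seq q) {A : ℝ} (hA : 0 ≤ A)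
    (h : ∑ i ∈ I, ‖v i‖ ^ q.toReal ≤ A ^ q.toReal) {ε : ℝ} (hε : 0 < ε) :
    ∀ᶠ r : ℕ in atTop, ‖∑ i ∈ I, shift q (r * K i) (v i)‖ ≤ A + ε := by
  have hq0 : 0 < q.toReal :=
    ENNReal.toReal_pos (lt_of_lt_of_le one_pos (Fact.out : 1 ≤ q)).ne' hq
  set δ : ℝ := ε / (I.card + 1)
  have hδ : 0 < δ := by positivity
  have hs : ∀ i, ∃ s : Finset ℤ, ‖v i - ∑ k ∈ s, lp.single q k (v i k)‖ < δ := by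
    intro i
    obtain ⟨s, hs⟩ := ((Metric.tendsto_nhds.1 (lp.hasSum_single hq (v i))) δ hδ).exists
    exact ⟨s, by rwa [dist_comm, dist_eq_norm] at hs⟩
  choose s hs using hs
  set w : ι → Seq q := fun i => ∑ k ∈ s i, lp.single q k (v i k)
  have hwapp : ∀ i k, w i k = if k ∈ s i then v i k else 0 := by
    intro i k
    simp only [w]
    rw [lp.coeFn_sum, Finset.sum_apply]
    by_cases hk : k ∈ s i
    · rw [if_pos hk, Finset.sum_eq_single_of_mem k hk]
      · simp
      · intro b _ hb
        simp [lp.single_apply, hb.symm]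
    · rw [if_neg hk]
      refine Finset.sum_eq_zero fun b hb => ?_
      have : k ≠ b := by rintro rfl; exact hk hb
      simp [lp.single_apply, this]
  have hw : ∀ i, ‖w i‖ ^ q.toReal ≤ ‖v i‖ ^ q.toReal := by
    intro i
    rw [lp.norm_sum_single hq0]
    exact lp.sum_rpow_le_norm_rpow hq0 (v i) (s i)
  obtain ⟨R, hR⟩ : ∃ R : ℕ, ∀ i ∈ I, ∀ k ∈ s i, k.natAbs ≤ R := by
    refine ⟨I.sup fun i => (s i).sup Int.natAbs, fun i hi k hk => ?_⟩
    exact (Finset.le_sup (f := Int.natAbs) hk).trans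
      (Finset.le_sup (f := fun i => (s i).sup Int.natAbs) hi)
  filter_upwards [eventually_gt_atTop (2 * R)] with r hr
  have hdisj : ‖∑ i ∈ I, shift q (r * K i) (w i)‖ ≤ A := by
    have hpt : ∀ k : ℤ, ‖(∑ i ∈ I, shift q (r * K i) (w i) : Seq q) k‖ ^ q.toReal ≤
        ∑ i ∈ I, ‖shift q (r * K i) (w i) k‖ ^ q.toReal := by
      intro k
      rw [lp.coeFn_sum, Finset.sum_apply]
      by_cases hz : ∀ i ∈ I, shift q (r * K i) (w i) k = 0
      · rw [Finset.sum_eq_zero hz, norm_zero, Real.zero_rpow hq0.ne']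
        positivity
      · push Not at hz
        obtain ⟨i, hi, hne⟩ := hz
        rw [Finset.sum_eq_single_of_mem i hi]
        · exact Finset.single_le_sum (f := fun i => ‖shift q (r * K i) (w i) k‖ ^ q.toReal)
            (fun j _ => by positivity) hi
        · intro j hj hji
          by_contra hne'
          have hmem : ∀ i ∈ I, shift q (r * K i) (w i) k ≠ 0 → (k - r * K i).natAbs ≤ R := by
            intro i hi hne
            rw [shift_apply, hwapp] at hne
            exact hR i hi _ (by by_contra hc; simp [hc] at hne)
          have h1 := hmem i hi hne
          have h2 := hmem j hj hne'
          have h3 : K i - K j ≠ 0 := fun h0 => hji (hK hj hi (by omega))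
          have h4 : ((r : ℤ) * (K i - K j)).natAbs ≤ 2 * R := by
            have : (r : ℤ) * (K i - K j) = (k - r * K j) - (k - r * K i) := by ring
            omega
          rw [Int.natAbs_mul, Int.natAbs_natCast] at h4
          have h5 : 1 ≤ (K i - K j).natAbs := Int.natAbs_pos.2 h3
          nlinarith
    have hsum : ∑ i ∈ I, ‖shift q (r * K i) (w i)‖ ^ q.toReal ≤ A ^ q.toReal := by
      refine le_trans (Finset.sum_le_sum fun i _ => ?_) h
      rw [norm_shift]
      exact hw i
    refine lp.norm_le_of_forall_sum_le hq0 hA fun t => ?_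
    refine (Finset.sum_le_sum fun k _ => hpt k).trans ?_
    rw [Finset.sum_comm]
    exact (Finset.sum_le_sum fun i _ => lp.sum_rpow_le_norm_rpow hq0 _ t).trans hsum
  have hdiff : ‖∑ i ∈ I, shift q (r * K i) (v i - w i)‖ ≤ ε := by
    refine (norm_sum_le _ _).trans ?_
    have : ∀ i ∈ I, ‖shift q (r * K i) (v i - w i)‖ ≤ δ := fun i _ => by
      rw [norm_shift]; exact (hs i).le
    refine (Finset.sum_le_card_nsmul _ _ _ this).trans ?_
    rw [nsmul_eq_mul, mul_div_assoc', div_le_iff₀ (by positivity)]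
    nlinarith
  calc _ = ‖∑ i ∈ I, shift q (r * K i) (w i) + ∑ i ∈ I, shift q (r * K i) (v i - w i)‖ := by
        rw [← Finset.sum_add_distrib]
        simp only [map_sub, add_sub_cancel]
    _ ≤ _ := (norm_add_le _ _).trans (add_le_add hdisj hdiff)

theorem exists_coeff_prod_linear (a b : ℕ → ℝ) (m : ℕ) : ∃ w : ℕ → ℝ, (∀ i, m < i → w i = 0) ∧
    (∀ y : ℝ, ∑ i ∈ Finset.range (m + 1), w i * y ^ i = ∏ k ∈ Finset.range m, (a k + b k * y)) ∧
    ∑ i ∈ Finset.range (m + 1), |w i| ≤ ∏ k ∈ Finset.range m, (|a k| + |b k|) := by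
  induction m with
  | zero => exact ⟨fun i => if i = 0 then 1 else 0, fun i hi => by simp [hi.ne'], by simp, by simp⟩
  | succ m ih =>
    obtain ⟨w, h0, h1, h2⟩ := ih
    refine ⟨fun i => a m * w i + b m * (if i = 0 then 0 else w (i - 1)), fun i hi => ?_,
      fun y => ?_, ?_⟩
    · simp [h0 i (by omega), h0 (i - 1) (by omega)]
    · simp only [add_mul, Finset.sum_add_distrib]
      rw [Finset.sum_range_succ, h0 (m + 1) (by omega), Finset.sum_range_succ' _ (m + 1),
        Finset.prod_range_succ, ← h1]
      simp only [mul_zero, zero_mul, add_zero, Nat.add_one_ne_zero, if_false, Nat.add_sub_cancel,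
        if_true, Finset.sum_mul, ← Finset.sum_add_distrib]
      refine Finset.sum_congr rfl fun i _ => ?_
      ring
    · have : ∑ i ∈ Finset.range (m + 1 + 1), |a m * w i + b m * (if i = 0 then 0 else w (i - 1))| ≤
          ∑ i ∈ Finset.range (m + 1 + 1), (|a m| * |w i| + |b m| * |if i = 0 then 0 else w (i - 1)|) := by
        refine Finset.sum_le_sum fun i _ => ?_
        rw [← abs_mul, ← abs_mul]
        exact abs_add_le _ _
      refine this.trans ?_
      rw [Finset.sum_add_distrib, Finset.sum_range_succ, h0 (m + 1) (by omega),
        Finset.sum_range_succ' _ (m + 1), Finset.prod_range_succ]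
      simp only [mul_zero, abs_zero, add_zero, Nat.add_one_ne_zero, if_false, Nat.add_sub_cancel,
        if_true, ← Finset.mul_sum]
      rw [← add_mul, mul_comm]
      gcongr

/-- Signed weights on nodes in `[σ, 2σ]` with total mass `1` and `M` vanishing moments, of
total variation at most exponential in `M`. -/
theorem exists_weights {M : ℕ} (hM : 1 ≤ M) {σ : ℝ} (hσ : 0 < σ) : ∃ w s : ℕ → ℝ,
    (∀ i ∈ Finset.range (M + 1), σ ≤ s i ∧ s i ≤ 2 * σ) ∧
    ∑ i ∈ Finset.range (M + 1), |w i| ≤ 17 ^ M ∧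
    ∑ i ∈ Finset.range (M + 1), w i = 1 ∧
    ∀ k, 1 ≤ k → k ≤ M → ∑ i ∈ Finset.range (M + 1), w i * s i ^ k = 0 := by
  have hM0 : (0 : ℝ) < M := by exact_mod_cast hM
  set c : ℝ := 1 + 1 / (2 * M)
  have hc1 : 1 < c := by simp only [c]; linarith [show 0 < 1 / (2 * (M : ℝ)) by positivity]
  have hcM : c ^ M ≤ 2 := by
    have h1 : c ≤ Real.exp (1 / (2 * M)) := by
      have := Real.add_one_le_exp (1 / (2 * (M : ℝ)))
      simp only [c]; linarith
    calc c ^ M ≤ Real.exp (1 / (2 * M)) ^ M := by gcongr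
      _ = Real.exp (1 / 2) := by
        rw [← Real.exp_nat_mul]
        congr 1
        field_simp
      _ ≤ 2 := by
        have h2 : Real.exp (1 / 2) ^ 2 ≤ 2 ^ 2 := by
          rw [← Real.exp_nat_mul]
          norm_num
          linarith [Real.exp_one_lt_d9]
        exact (abs_le_of_sq_le_sq' h2 (by norm_num)).2
  have hck : ∀ k ≤ M, c ^ k ≤ 2 := fun k hk => (pow_le_pow_right₀ hc1.le hk).trans hcM
  have hcl : ∀ k : ℕ, ((k + 1 : ℕ) : ℝ) / (2 * M) ≤ c ^ (k + 1) - 1 := by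
    intro k
    have := one_add_mul_le_pow (a := 1 / (2 * (M : ℝ)))
      (by linarith [show 0 < 1 / (2 * (M : ℝ)) by positivity]) (k + 1)
    simp only [c]
    rw [le_sub_iff_add_le, add_comm]
    refine le_trans (le_of_eq ?_) this
    ring
  have hpos : ∀ k : ℕ, 0 < c ^ (k + 1) - 1 := fun k => lt_of_lt_of_le (by positivity) (hcl k)
  obtain ⟨w, -, h1, h2⟩ := exists_coeff_prod_linear (fun k => c ^ (k + 1) / (c ^ (k + 1) - 1))
    (fun k => -1 / (c ^ (k + 1) - 1)) M
  refine ⟨w, fun i => σ * c ^ i, fun i hi => ⟨?_, ?_⟩, h2.trans ?_, ?_, fun k hk1 hk2 => ?_⟩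
  · have : 1 ≤ c ^ i := one_le_pow₀ hc1.le
    nlinarith
  · have : c ^ i ≤ 2 := hck i (by simpa [Nat.lt_succ_iff] using hi)
    nlinarith
  · have hb : ∀ k ∈ Finset.range M, |c ^ (k + 1) / (c ^ (k + 1) - 1)| + |-1 / (c ^ (k + 1) - 1)| ≤
        6 * M / ((k + 1 : ℕ) : ℝ) := by
      intro k hk
      have hk' : k + 1 ≤ M := Finset.mem_range.1 hk
      rw [abs_of_pos (by have := hpos k; positivity), abs_div, abs_of_pos (hpos k), abs_neg,
        abs_one, ← add_div, div_le_div_iff₀ (hpos k) (by positivity)]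
      have h3 := hcl k
      rw [div_le_iff₀ (by positivity)] at h3
      have h4 := hck _ hk'
      have h5 : (0 : ℝ) ≤ ((k + 1 : ℕ) : ℝ) := by positivity
      nlinarith
    refine (Finset.prod_le_prod (fun k _ => by positivity) hb).trans ?_
    rw [Finset.prod_div_distrib, Finset.prod_const, Finset.card_range, ← Nat.cast_prod,
      Finset.prod_range_add_one_eq_factorial, mul_pow, mul_div_assoc]
    have h3 := Real.pow_div_factorial_le_exp (M : ℝ) hM0.le M
    have h4 : Real.exp M = Real.exp 1 ^ M := by rw [← Real.exp_nat_mul, mul_one]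
    calc (6 : ℝ) ^ M * (M ^ M / M.factorial) ≤ 6 ^ M * Real.exp 1 ^ M := by
          rw [← h4]; gcongr
      _ = (6 * Real.exp 1) ^ M := by rw [mul_pow]
      _ ≤ 17 ^ M := by
        gcongr
        linarith [Real.exp_one_lt_d9]
  · have := h1 1
    simp only [one_pow, mul_one] at this
    rw [this]
    refine Finset.prod_eq_one fun k _ => ?_
    rw [← add_div]
    exact div_self (hpos k).ne'
  · have := h1 (c ^ k)
    have h3 : ∑ i ∈ Finset.range (M + 1), w i * (σ * c ^ i) ^ k =
        σ ^ k * ∑ i ∈ Finset.range (M + 1), w i * (c ^ k) ^ i := by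
      rw [Finset.mul_sum]
      refine Finset.sum_congr rfl fun i _ => ?_
      rw [mul_pow, ← pow_mul, ← pow_mul, mul_comm i k]
      ring
    rw [h3, this, Finset.prod_eq_zero (i := k - 1) (by simp; omega), mul_zero]
    rw [Nat.sub_add_cancel hk1]
    ring

/-- The mean of `(1 + sφ cos)² (1 + λ cos + κ λ² cos²)` against its exponential penalty, where
`λ = 2σ` and `κ = 17/32`. -/
theorem mean_mul_exp_le {σ s φ : ℝ} (hσ : 0 < σ) (hσ' : σ ≤ 1 / 16) (hs : σ ≤ s) (hs' : s ≤ 2 * σ)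
    (hφ : |φ| ≤ 1) :
    0 ≤ 1 + s ^ 2 * φ ^ 2 / 2 + s * φ * (2 * σ) + 17 / 32 * (2 * σ) ^ 2 / 2
      + 3 / 8 * (17 / 32) * (2 * σ) ^ 2 * (s ^ 2 * φ ^ 2) ∧
    (1 + s ^ 2 * φ ^ 2 / 2 + s * φ * (2 * σ) + 17 / 32 * (2 * σ) ^ 2 / 2
      + 3 / 8 * (17 / 32) * (2 * σ) ^ 2 * (s ^ 2 * φ ^ 2)) *
      Real.exp (-(4 * σ ^ 2 * (φ + 15 / 16))) ≤ Real.exp (-(σ ^ 2 / 8)) := by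
  obtain ⟨h1, h2⟩ := abs_le.1 hφ
  constructor
  · have : -1 ≤ s * φ * (2 * σ) := by nlinarith [mul_nonneg hσ.le (hσ.le.trans hs)]
    have h3 : 0 ≤ s ^ 2 * φ ^ 2 := by positivity
    have h4 : 0 ≤ 3 / 8 * (17 / 32) * (2 * σ) ^ 2 * (s ^ 2 * φ ^ 2) := by positivity
    have h5 : 0 ≤ 17 / 32 * (2 * σ) ^ 2 / 2 := by positivity
    linarith
  · obtain ⟨a, rfl⟩ : ∃ a, s = σ * a := ⟨s / σ, by field_simp⟩
    have ha1 : 1 ≤ a := by nlinarith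
    have ha2 : a ≤ 2 := by nlinarith
    set H := 1 + (σ * a) ^ 2 * φ ^ 2 / 2 + σ * a * φ * (2 * σ) + 17 / 32 * (2 * σ) ^ 2 / 2
      + 3 / 8 * (17 / 32) * (2 * σ) ^ 2 * ((σ * a) ^ 2 * φ ^ 2) with hH
    have hexp : H ≤ Real.exp (H - 1) := by linarith [Real.add_one_le_exp (H - 1)]
    calc H * _ ≤ Real.exp (H - 1) * _ := by gcongr
      _ = Real.exp (H - 1 + -(4 * σ ^ 2 * (φ + 15 / 16))) := by rw [Real.exp_add]
      _ ≤ _ := by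
        apply Real.exp_le_exp.2
        have hφ2 : φ ^ 2 ≤ 1 := by nlinarith
        have ha3 : a ^ 2 ≤ 4 := by nlinarith
        have hσ2 : σ ^ 2 ≤ 1 / 256 := by nlinarith
        have hap : a ^ 2 * φ ^ 2 ≤ 4 := by nlinarith [sq_nonneg φ]
        have key : a ^ 2 * φ ^ 2 / 2 + 2 * a * φ + 17 / 16 - 4 * φ - 15 / 4 ≤ - 3 / 16 := by
          nlinarith [mul_nonneg (sub_nonneg.2 ha1) (sub_nonneg.2 ha2),
            mul_nonneg (sub_nonneg.2 h1) (sub_nonneg.2 h2), sq_nonneg φ,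
            mul_nonneg (mul_nonneg (sub_nonneg.2 ha1) (sub_nonneg.2 ha2)) (sub_nonneg.2 h2), 
            mul_nonneg (mul_nonneg (sub_nonneg.2 ha1) (sub_nonneg.2 ha2)) (sub_nonneg.2 h1), 
            mul_nonneg (sub_nonneg.2 ha1) (sub_nonneg.2 h2), mul_nonneg (sub_nonneg.2 ha2) (sub_nonneg.2 h2)]
        have hsmall : 3 / 8 * (17 / 32) * 4 * (σ ^ 2 * (a ^ 2 * φ ^ 2)) ≤ 1 / 64 := by
          nlinarith [sq_nonneg σ]
        have heq : H - 1 + -(4 * σ ^ 2 * (φ + 15 / 16)) = σ ^ 2 *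
            ((a ^ 2 * φ ^ 2 / 2 + 2 * a * φ + 17 / 16 - 4 * φ - 15 / 4) +
              3 / 8 * (17 / 32) * 4 * (σ ^ 2 * (a ^ 2 * φ ^ 2))) := by
          rw [hH]; ring
        rw [heq]
        nlinarith [sq_nonneg σ]

theorem exp_le_quadratic {x : ℝ} (hx : |x| ≤ 1 / 8) : Real.exp x ≤ 1 + x + 17 / 32 * x ^ 2 := by
  have h := Real.exp_bound (x := x) (by linarith) (n := 3) (by norm_num)
  simp only [Finset.sum_range_succ, Finset.sum_range_zero] at h
  norm_num [Nat.factorial] at h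
  have h2 := (abs_le.1 h).2
  have h3 : |x| ^ 3 ≤ 1 / 8 * x ^ 2 := by
    rw [pow_succ, sq_abs]
    nlinarith [sq_nonneg x]
  nlinarith [sq_nonneg x]

/-- The function `t ↦ cos (n t)` on the circle. -/
noncomputable def cosine (n : ℤ) (t : Circ) : ℝ := (fourier n t : ℂ).re

theorem cosine_eq (n : ℤ) (t : Circ) :
    (cosine n t : ℂ) = (fourier n t + fourier (-n) t) / 2 := by
  rw [fourier_neg, cosine, Complex.re_eq_add_conj]

theorem continuous_cosine (n : ℤ) : Continuous (cosine n) :=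
  Complex.continuous_re.comp (fourier n).continuous

theorem abs_cosine_le (n : ℤ) (t : Circ) : |cosine n t| ≤ 1 := by
  refine (Complex.abs_re_le_norm _).trans ?_
  rw [fourier_apply, Circle.norm_coe]

/-- The integer with (signed) decimal digits `k`. -/
def digitSum {N : ℕ} (k : Fin N → ℤ) : ℤ := ∑ j, k j * 10 ^ (j : ℕ)

theorem eq_zero_of_digitSum_eq_zero {N : ℕ} (k : Fin N → ℤ) (h : ∀ j, |k j| ≤ 8)
    (h0 : digitSum k = 0) : k = 0 := by
  induction N with
  | zero => exact Subsingleton.elim _ _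
  | succ N ih =>
    have h1 : digitSum k = k 0 + 10 * digitSum (fun j : Fin N => k j.succ) := by
      rw [digitSum, Fin.sum_univ_succ, digitSum, Finset.mul_sum]
      simp only [Fin.val_zero, pow_zero, mul_one, Fin.val_succ]
      congr 1
      refine Finset.sum_congr rfl fun j _ => ?_
      ring
    have h2 := abs_le.1 (h 0)
    rw [h0] at h1
    have h3 : digitSum (fun j : Fin N => k j.succ) = 0 := by omega
    have h4 := ih _ (fun j => h j.succ) h3
    funext j
    refine Fin.cases ?_ (fun j => ?_) j
    · simp only [Pi.zero_apply]; omega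
    · exact congrFun h4 j

theorem digitSum_inj {N : ℕ} {k l : Fin N → ℤ} (hk : ∀ j, |k j| ≤ 4) (hl : ∀ j, |l j| ≤ 4)
    (h : digitSum k = digitSum l) : k = l := by
  rw [← sub_eq_zero]
  apply eq_zero_of_digitSum_eq_zero
  · intro j
    have h1 := abs_le.1 (hk j)
    have h2 := abs_le.1 (hl j)
    rw [Pi.sub_apply, abs_le]
    omega
  · have : digitSum (k - l) = digitSum k - digitSum l := by
      simp [digitSum, sub_mul]
    omega

theorem prod_sum_fourier (N : ℕ) (S : Finset ℤ) (a : ℤ → ℂ) (r : ℤ) (t : Circ) :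
    ∏ j : Fin N, ∑ κ ∈ S, a κ * fourier (κ * (10 ^ (j : ℕ) * r)) t =
      ∑ k ∈ Fintype.piFinset fun _ : Fin N => S,
        (∏ j, a (k j)) * fourier (r * digitSum k) t := by
  rw [Finset.prod_univ_sum]
  refine Finset.sum_congr rfl fun k _ => ?_
  rw [Finset.prod_mul_distrib]
  congr 1
  rw [digitSum, Finset.mul_sum]
  have : ∀ (s : Finset (Fin N)), ∏ j ∈ s, (fourier (k j * (10 ^ (j : ℕ) * r)) t : ℂ) =
      fourier (∑ j ∈ s, r * (k j * 10 ^ (j : ℕ))) t := by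
    intro s
    induction s using Finset.induction_on with
    | empty => simp
    | insert j s hj ih =>
      rw [Finset.prod_insert hj, Finset.sum_insert hj, ih, fourier_add]
      congr 3
      ring
  exact this _

theorem sum_piFinset_pow (N : ℕ) (x : ℝ) :
    ∑ k ∈ Fintype.piFinset fun _ : Fin N => Finset.Icc (-1 : ℤ) 1, x ^ (∑ j, (k j).natAbs) =
      (1 + 2 * x) ^ N := by
  have h := Finset.prod_univ_sum (fun _ : Fin N => Finset.Icc (-1 : ℤ) 1)
    (fun _ κ => x ^ κ.natAbs)
  simp only [Finset.prod_const, Finset.card_univ, Fintype.card_fin, Finset.prod_pow_eq_pow_sum] at h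
  rw [← h]
  congr 1
  rw [show Finset.Icc (-1 : ℤ) 1 = {-1, 0, 1} from rfl]
  simp
  ring

section
variable {φ : Circ → ℝ}

theorem memLp_comp (hφ : Measurable φ) (hφ1 : ∀ t, |φ t| ≤ 1) {g : ℝ → ℂ} (hg : Continuous g) :
    MemLp (fun t => g (φ t)) 2 haar := by
  obtain ⟨C, hC⟩ := (isCompact_Icc (a := (-1 : ℝ)) (b := 1)).exists_bound_of_continuousOn
    hg.continuousOn
  exact memLp_of_bound (hg.measurable.comp hφ) fun t => hC _ (abs_le.1 (hφ1 t))

theorem riesz_eq {N : ℕ} (s : ℝ) (r : ℕ) (t : Circ) :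
    ((∏ j : Fin N, (1 + s * φ t * cosine (10 ^ (j : ℕ) * r) t) : ℝ) : ℂ) =
      ∑ k ∈ Fintype.piFinset fun _ : Fin N => Finset.Icc (-1 : ℤ) 1,
        (s * φ t / 2 : ℂ) ^ (∑ j, (k j).natAbs) * fourier (r * digitSum k) t := by
  have h := prod_sum_fourier N (Finset.Icc (-1 : ℤ) 1) (fun κ => (s * φ t / 2 : ℂ) ^ κ.natAbs) r t
  simp only [Finset.prod_pow_eq_pow_sum] at h
  rw [← h, Complex.ofReal_prod]
  refine Finset.prod_congr rfl fun j _ => ?_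
  push_cast
  rw [cosine_eq, show Finset.Icc (-1 : ℤ) 1 = {-1, 0, 1} from rfl]
  simp
  ring

theorem eventually_norm_fc_riesz_sub_le {q : ENNReal} [Fact (1 ≤ q)] [Fact (2 ≤ q)] (hq : q ≠ ⊤)
    (hφ : Measurable φ) (hφ1 : ∀ t, |φ t| ≤ 1) {B : Circ → ℝ} (hB : Measurable B) {β : ℝ}
    (hBβ : ∀ t, |B t| ≤ β) {M : ℕ} {σ : ℝ} (hσ : 0 < σ) {w s : ℕ → ℝ}
    (hs : ∀ i ∈ Finset.range (M + 1), σ ≤ s i ∧ s i ≤ 2 * σ)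
    (hw : ∑ i ∈ Finset.range (M + 1), |w i| ≤ 17 ^ M)
    (hw1 : ∑ i ∈ Finset.range (M + 1), w i = 1)
    (hw0 : ∀ k, 1 ≤ k → k ≤ M → ∑ i ∈ Finset.range (M + 1), w i * s i ^ k = 0)
    (N : ℕ) {L A : ℝ} (hL : 1 ≤ L) (hA : 0 ≤ A)
    (hLA : (β * 17 ^ M) ^ q.toReal * (L ^ M)⁻¹ * (1 + 2 * (L * σ ^ q.toReal)) ^ N ≤ A ^ q.toReal)
    {ε : ℝ} (hε : 0 < ε) :
    ∀ᶠ r : ℕ in atTop, ‖fc q (fun t => ((B t * ∑ i ∈ Finset.range (M + 1),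
        w i * ∏ j : Fin N, (1 + s i * φ t * cosine (10 ^ (j : ℕ) * r) t) : ℝ) : ℂ)) -
      fc q (fun t => (B t : ℂ))‖ ≤ A + ε := by
  classical
  have hq0 : 0 < q.toReal :=
    ENNReal.toReal_pos (lt_of_lt_of_le one_pos (Fact.out : 1 ≤ q)).ne' hq
  have hβ : 0 ≤ β := (abs_nonneg _).trans (hBβ 0)
  set I := Fintype.piFinset fun _ : Fin N => Finset.Icc (-1 : ℤ) 1 with hI
  set d : (Fin N → ℤ) → ℕ := fun k => ∑ j, (k j).natAbs
  set c : (Fin N → ℤ) → ℝ := fun k => (2 ^ d k)⁻¹ * ∑ i ∈ Finset.range (M + 1), w i * s i ^ d k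
  set u : (Fin N → ℤ) → Circ → ℂ := fun k t => (B t : ℂ) * (φ t : ℂ) ^ d k
  have hu_meas : ∀ k, Measurable (u k) := fun k =>
    (measurable_ofReal.comp hB).mul ((measurable_ofReal.comp hφ).pow_const _)
  have hu_bd : ∀ k t, ‖u k t‖ ≤ β := fun k t => by
    simp only [u, norm_mul, norm_pow, Complex.norm_real, Real.norm_eq_abs]
    calc _ ≤ β * 1 := by
          gcongr
          · exact hBβ t
          · exact pow_le_one₀ (abs_nonneg _) (hφ1 t)
      _ = β := mul_one β
  have hu : ∀ k, MemLp (u k) 2 haar := fun k => memLp_of_bound (hu_meas k) (hu_bd k)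
  have hfu : ∀ (n : ℤ) k, MemLp (fun t => fourier n t * u k t) 2 haar := fun n k =>
    memLp_of_bound ((fourier n).continuous.measurable.mul (hu_meas k)) (β := β) fun t => by
      rw [norm_mul, fourier_apply, Circle.norm_coe, one_mul]
      exact hu_bd k t
  have hexp : ∀ r : ℕ, fc q (fun t => ((B t * ∑ i ∈ Finset.range (M + 1),
      w i * ∏ j : Fin N, (1 + s i * φ t * cosine (10 ^ (j : ℕ) * r) t) : ℝ) : ℂ)) =
      ∑ k ∈ I, shift q (r * digitSum k) ((c k : ℂ) • fc q (u k)) := by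
    intro r
    have h1 : (fun t => ((B t * ∑ i ∈ Finset.range (M + 1),
        w i * ∏ j : Fin N, (1 + s i * φ t * cosine (10 ^ (j : ℕ) * r) t) : ℝ) : ℂ)) =
        fun t => ∑ k ∈ I, (c k : ℂ) * (fourier (r * digitSum k) t * u k t) := by
      funext t
      rw [Complex.ofReal_mul, Complex.ofReal_sum]
      simp only [Complex.ofReal_mul (w _), riesz_eq, Finset.mul_sum]
      rw [Finset.sum_comm]
      refine Finset.sum_congr rfl fun k _ => ?_
      simp only [c, u]
      push_cast
      rw [Finset.mul_sum, Finset.sum_mul]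
      refine Finset.sum_congr rfl fun i _ => ?_
      rw [div_pow, mul_pow]
      ring
    rw [h1, fc_sum _ _ fun k _ => (hfu _ k).const_mul _]
    refine Finset.sum_congr rfl fun k _ => ?_
    rw [fc_const_mul (hfu _ k), fc_fourier_mul (hu k), map_smul]
  have hI0 : (0 : Fin N → ℤ) ∈ I := by simp [hI]
  have hd0 : d 0 = 0 := by simp [d]
  have hIabs : ∀ k ∈ I, ∀ j, |k j| ≤ 4 := by
    intro k hk j
    have := Finset.mem_Icc.1 (Fintype.mem_piFinset.1 hk j)
    rw [abs_le]; omega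
  have hsub : ∀ r : ℕ, fc q (fun t => ((B t * ∑ i ∈ Finset.range (M + 1),
      w i * ∏ j : Fin N, (1 + s i * φ t * cosine (10 ^ (j : ℕ) * r) t) : ℝ) : ℂ)) -
      fc q (fun t => (B t : ℂ)) =
      ∑ k ∈ I.erase 0, shift q (r * digitSum k) ((c k : ℂ) • fc q (u k)) := by
    intro r
    rw [hexp, ← Finset.add_sum_erase I _ hI0, add_sub_assoc, add_comm, sub_add_eq_add_sub,
      sub_eq_iff_eq_add]
    congr 1
    have h1 : c 0 = 1 := by simp [c, hd0, hw1]
    have h2 : digitSum (0 : Fin N → ℤ) = 0 := by simp [digitSum]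
    have h3 : u 0 = fun t => (B t : ℂ) := by funext t; simp [u, hd0]
    rw [h1, h2, h3, mul_zero, shift_zero]
    simp
  simp only [hsub]
  refine eventually_norm_sum_shift_le hq (I.erase 0) digitSum ?_
    (fun k => (c k : ℂ) • fc q (u k)) hA ?_ hε
  · intro k hk l hl h
    exact digitSum_inj (hIabs k (Finset.mem_of_mem_erase hk)) (hIabs l (Finset.mem_of_mem_erase hl)) h
  · have hterm : ∀ k ∈ I.erase 0, ‖(c k : ℂ) • fc q (u k)‖ ^ q.toReal ≤
        (β * 17 ^ M) ^ q.toReal * (L ^ M)⁻¹ * (L * σ ^ q.toReal) ^ d k := by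
      intro k hk
      have hk0 : k ≠ 0 := Finset.ne_of_mem_erase hk
      have hdk : 1 ≤ d k := by
        by_contra hlt
        apply hk0
        have h0 : d k = 0 := by omega
        funext j
        have := Finset.sum_eq_zero_iff.1 h0 j (Finset.mem_univ j)
        simpa using this
      by_cases hdM : d k ≤ M
      · have : c k = 0 := by simp only [c]; rw [hw0 _ hdk hdM, mul_zero]
        rw [this]
        simp only [Complex.ofReal_zero, zero_smul, norm_zero]
        rw [Real.zero_rpow hq0.ne']
        positivity
      · push Not at hdM
        have hc : |c k| ≤ 17 ^ M * σ ^ d k := by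
          simp only [c]
          rw [abs_mul, abs_of_nonneg (by positivity)]
          have : |∑ i ∈ Finset.range (M + 1), w i * s i ^ d k| ≤ 17 ^ M * (2 * σ) ^ d k := by
            refine (Finset.abs_sum_le_sum_abs _ _).trans ?_
            refine (Finset.sum_le_sum (g := fun i => |w i| * (2 * σ) ^ d k) fun i hi => ?_).trans ?_
            · have := hs i hi
              rw [abs_mul, abs_pow, abs_of_nonneg (hσ.le.trans this.1)]
              gcongr
              · exact hσ.le.trans this.1
              · exact this.2
            · rw [← Finset.sum_mul]
              gcongr
          calc _ ≤ (2 ^ d k)⁻¹ * (17 ^ M * (2 * σ) ^ d k) := by gcongr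
            _ = _ := by rw [mul_pow]; field_simp
        have hn : ‖(c k : ℂ) • fc q (u k)‖ ≤ (β * 17 ^ M) * σ ^ d k := by
          rw [norm_smul, Complex.norm_real, Real.norm_eq_abs]
          calc _ ≤ (17 ^ M * σ ^ d k) * β := by
                gcongr
                exact norm_fc_le_of_bound hq (hu k) hβ (hu_bd k)
            _ = _ := by ring
        calc _ ≤ ((β * 17 ^ M) * σ ^ d k) ^ q.toReal := by gcongr
          _ = (β * 17 ^ M) ^ q.toReal * (σ ^ q.toReal) ^ d k := by
            rw [Real.mul_rpow (by positivity) (by positivity), ← Real.rpow_natCast_mul hσ.le,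
              mul_comm (d k : ℝ), Real.rpow_mul_natCast hσ.le]
          _ ≤ (β * 17 ^ M) ^ q.toReal * ((L ^ M)⁻¹ * (L ^ d k * (σ ^ q.toReal) ^ d k)) := by
            have : 1 ≤ (L ^ M)⁻¹ * L ^ d k := by
              rw [inv_mul_eq_div, one_le_div (by positivity)]
              exact pow_le_pow_right₀ hL hdM.le
            gcongr
            rw [← mul_assoc]
            exact le_mul_of_one_le_left (by positivity) this
          _ = _ := by rw [mul_pow]; ring
    refine (Finset.sum_le_sum hterm).trans (le_trans ?_ hLA)
    rw [← Finset.mul_sum, ← sum_piFinset_pow]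
    gcongr
    exact Finset.erase_subset _ _

end

section
variable {φ : Circ → ℝ}

theorem tendsto_integral_prod (hφ : Measurable φ) (hφ1 : ∀ t, |φ t| ≤ 1) (N : ℕ)
    {D : ℝ → ℂ} (hD : Continuous D) {a : ℤ → ℝ → ℂ} (ha : ∀ κ, Continuous (a κ)) :
    Tendsto (fun r : ℕ => ∫ t, D (φ t) * ∏ j : Fin N, ∑ κ ∈ Finset.Icc (-4 : ℤ) 4,
      a κ (φ t) * fourier (κ * (10 ^ (j : ℕ) * r)) t ∂haar) atTop
      (𝓝 (∫ t, D (φ t) * a 0 (φ t) ^ N ∂haar)) := by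
  classical
  set I := Fintype.piFinset fun _ : Fin N => Finset.Icc (-4 : ℤ) 4 with hI
  set g : (Fin N → ℤ) → ℝ → ℂ := fun k x => D x * ∏ j, a (k j) x
  have hg : ∀ k, MemLp (fun t => g k (φ t)) 2 haar := fun k =>
    memLp_comp hφ hφ1 (hD.mul (continuous_finsetProd _ fun j _ => ha (k j)))
  have hInt : ∀ (k : Fin N → ℤ) (n : ℤ), Integrable (fun t => g k (φ t) * fourier n t) haar := by
    intro k n
    have := ((hg k).integrable one_le_two).fourier_smul n
    simpa only [smul_eq_mul, mul_comm] using this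
  have h1 : ∀ r : ℕ, ∫ t, D (φ t) * ∏ j : Fin N, ∑ κ ∈ Finset.Icc (-4 : ℤ) 4,
      a κ (φ t) * fourier (κ * (10 ^ (j : ℕ) * r)) t ∂haar =
      ∑ k ∈ I, ∫ t, g k (φ t) * fourier (r * digitSum k) t ∂haar := by
    intro r
    rw [← integral_finsetSum _ fun k _ => hInt k _]
    congr 1
    funext t
    rw [prod_sum_fourier, Finset.mul_sum]
    refine Finset.sum_congr rfl fun k _ => ?_
    rw [← mul_assoc]
  simp only [h1]
  have h2 : ∫ t, D (φ t) * a 0 (φ t) ^ N ∂haar =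
      ∑ k ∈ I, if k = 0 then ∫ t, g 0 (φ t) ∂haar else 0 := by
    rw [Finset.sum_ite_eq', if_pos (by simp [hI])]
    simp [g]
  rw [h2]
  refine tendsto_finsetSum _ fun k hk => ?_
  by_cases hk0 : k = 0
  · subst hk0
    simp [digitSum]
  · rw [if_neg hk0]
    refine tendsto_integral_fourier_mul (hg k) fun h => hk0 ?_
    apply eq_zero_of_digitSum_eq_zero k _ h
    intro j
    have := Finset.mem_Icc.1 (Fintype.mem_piFinset.1 hk j)
    rw [abs_le]; omega

/-- The Fourier coefficients of `∑ i ≤ 4, pᵢ cosⁱ`. -/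
noncomputable def cosPolyCoeff (p0 p1 p2 p3 p4 : ℝ) (κ : ℤ) : ℝ :=
  if κ.natAbs = 0 then p0 + p2 / 2 + 3 / 8 * p4
  else if κ.natAbs = 1 then p1 / 2 + 3 / 8 * p3
  else if κ.natAbs = 2 then p2 / 4 + p4 / 4
  else if κ.natAbs = 3 then p3 / 8 else p4 / 16

theorem cosPoly_eq (p0 p1 p2 p3 p4 : ℝ) (n : ℤ) (t : Circ) :
    ((p0 + p1 * cosine n t + p2 * cosine n t ^ 2 + p3 * cosine n t ^ 3 +
      p4 * cosine n t ^ 4 : ℝ) : ℂ) =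
    ∑ κ ∈ Finset.Icc (-4 : ℤ) 4, (cosPolyCoeff p0 p1 p2 p3 p4 κ : ℂ) * fourier (κ * n) t := by
  have hpow : ∀ m : ℕ, (fourier ((m : ℤ) * n) t : ℂ) = fourier n t ^ m := by
    intro m
    induction m with
    | zero => simp
    | succ m ih => rw [pow_succ, ← ih, ← fourier_add]; congr 2; push_cast; ring
  have hpow' : ∀ m : ℕ, (fourier (-(m : ℤ) * n) t : ℂ) = fourier (-n) t ^ m := by
    intro m
    induction m with
    | zero => simp
    | succ m ih => rw [pow_succ, ← ih, ← fourier_add]; congr 2; push_cast; ring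
  have hone : (fourier n t : ℂ) * fourier (-n) t = 1 := by
    rw [← fourier_add, add_neg_cancel, fourier_zero]
  rw [show Finset.Icc (-4 : ℤ) 4 = {-4, -3, -2, -1, 0, 1, 2, 3, 4} from rfl]
  have e2 := hpow 2; have e3 := hpow 3; have e4 := hpow 4
  have f2 := hpow' 2; have f3 := hpow' 3; have f4 := hpow' 4
  have e0 : (fourier 0 t : ℂ) = 1 := fourier_zero
  push_cast at e2 e3 e4 f2 f3 f4
  rw [neg_mul] at f2 f3 f4
  push_cast
  rw [cosine_eq]
  simp [-fourier_neg', -fourier_apply, cosPolyCoeff, e0, e2, e3, e4, f2, f3, f4]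
  set z : ℂ := fourier n t
  set y : ℂ := fourier (-n) t
  linear_combination (p2 / 2 + 3 / 8 * p3 * (z + y) + p4 / 4 * (z ^ 2 + y ^ 2) +
    3 / 8 * p4 * (z * y + 1)) * hone

theorem integrable_of_measurable_bound {f : Circ → ℝ} (hf : Measurable f) {C : ℝ}
    (h : ∀ t, |f t| ≤ C) : Integrable f haar :=
  Integrable.of_bound hf.aestronglyMeasurable C (Eventually.of_forall h)

theorem eventually_integral_riesz_sq_le (hφ : Measurable φ) (hφ1 : ∀ t, |φ t| ≤ 1) (N : ℕ)
    {σ s η : ℝ} (hσ : 0 < σ) (hσ' : σ ≤ 1 / 16) (hs : σ ≤ s) (hs' : s ≤ 2 * σ)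
    (hη : η = 1 ∨ η = -1) :
    ∀ᶠ r : ℕ in atTop, ∫ t, Set.indicator {t | η * φ t + 15 / 16 <
        η * ((2 * σ * N)⁻¹ * ∑ j : Fin N, cosine (10 ^ (j : ℕ) * r) t)}
      (fun t => (∏ j : Fin N, (1 + s * φ t * cosine (10 ^ (j : ℕ) * r) t)) ^ 2) t ∂haar ≤
      3 / 2 * Real.exp (-(σ ^ 2 / 8) * N) := by
  have hη2 : η ^ 2 = 1 := by rcases hη with rfl | rfl <;> norm_num
  have hηabs : |η| = 1 := by rcases hη with rfl | rfl <;> norm_num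
  set l : ℝ := η * (2 * σ)
  set κ : ℝ := 17 / 32
  set P0 : ℝ → ℝ := fun _ => 1
  set P1 : ℝ → ℝ := fun x => 2 * s * x + l
  set P2 : ℝ → ℝ := fun x => s ^ 2 * x ^ 2 + 2 * s * x * l + κ * l ^ 2
  set P3 : ℝ → ℝ := fun x => s ^ 2 * x ^ 2 * l + 2 * s * x * κ * l ^ 2
  set P4 : ℝ → ℝ := fun x => κ * l ^ 2 * s ^ 2 * x ^ 2
  set a : ℤ → ℝ → ℂ := fun n x => (cosPolyCoeff (P0 x) (P1 x) (P2 x) (P3 x) (P4 x) n : ℂ)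
  set D : ℝ → ℝ := fun x => Real.exp (-(4 * σ ^ 2 * (η * x + 15 / 16)) * N)
  have ha : ∀ n, Continuous (a n) := by
    intro n
    simp only [a, cosPolyCoeff, P0, P1, P2, P3, P4]
    refine Complex.continuous_ofReal.comp ?_
    split_ifs <;> fun_prop
  have hD : Continuous D := by simp only [D]; fun_prop
  set E : ℕ → Circ → ℝ := fun r t => D (φ t) * ∏ j : Fin N,
    ((1 + s * φ t * cosine (10 ^ (j : ℕ) * r) t) ^ 2 *
      (1 + l * cosine (10 ^ (j : ℕ) * r) t + κ * (l * cosine (10 ^ (j : ℕ) * r) t) ^ 2))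
  have hEeq : ∀ (r : ℕ) t, ((E r t : ℝ) : ℂ) = (D (φ t) : ℂ) * ∏ j : Fin N,
      ∑ n ∈ Finset.Icc (-4 : ℤ) 4, a n (φ t) * fourier (n * (10 ^ (j : ℕ) * r)) t := by
    intro r t
    simp only [E]
    rw [Complex.ofReal_mul, Complex.ofReal_prod]
    congr 1
    refine Finset.prod_congr rfl fun j _ => ?_
    rw [← cosPoly_eq]
    congr 1
    simp only [P0, P1, P2, P3, P4]
    ring
  have hlim := tendsto_integral_prod hφ hφ1 N (D := fun x => (D x : ℂ))
    (Complex.continuous_ofReal.comp hD) ha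
  simp only [← hEeq] at hlim
  have ha0 : ∀ x, a 0 x = ((1 + s ^ 2 * (η * x) ^ 2 / 2 + s * (η * x) * (2 * σ) +
      17 / 32 * (2 * σ) ^ 2 / 2 + 3 / 8 * (17 / 32) * (2 * σ) ^ 2 * (s ^ 2 * (η * x) ^ 2) : ℝ) : ℂ) := by
    intro x
    simp only [a, cosPolyCoeff, P0, P2, P4]
    congr 1
    simp only [Int.natAbs_zero, if_true, l, κ, mul_pow, hη2]
    ring
  set H : ℝ → ℝ := fun x => 1 + s ^ 2 * (η * x) ^ 2 / 2 + s * (η * x) * (2 * σ) +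
      17 / 32 * (2 * σ) ^ 2 / 2 + 3 / 8 * (17 / 32) * (2 * σ) ^ 2 * (s ^ 2 * (η * x) ^ 2)
  have hHc : Continuous H := by simp only [H]; fun_prop
  have hlimeq : ∫ t, (D (φ t) : ℂ) * a 0 (φ t) ^ N ∂haar =
      ((∫ t, D (φ t) * H (φ t) ^ N ∂haar : ℝ) : ℂ) := by
    rw [← integral_complex_ofReal]
    congr 1
    funext t
    rw [ha0, ← Complex.ofReal_pow, ← Complex.ofReal_mul]
  rw [hlimeq] at hlim
  have hlim2 : Tendsto (fun r => ∫ t, E r t ∂haar) atTop (𝓝 (∫ t, D (φ t) * H (φ t) ^ N ∂haar)) := by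
    have := (Complex.continuous_re.tendsto _).comp hlim
    refine this.congr fun r => ?_
    simp only [Function.comp_apply]
    rw [integral_complex_ofReal, Complex.ofReal_re]
  have hptH : ∀ t, D (φ t) * H (φ t) ^ N ≤ Real.exp (-(σ ^ 2 / 8) * N) := by
    intro t
    have hx : |η * φ t| ≤ 1 := by rw [abs_mul, hηabs, one_mul]; exact hφ1 t
    obtain ⟨h0, h1⟩ := mean_mul_exp_le hσ hσ' hs hs' hx
    simp only [D]
    rw [mul_comm _ (N : ℝ), mul_comm _ (N : ℝ), Real.exp_nat_mul, Real.exp_nat_mul, ← mul_pow,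
      mul_comm]
    refine pow_le_pow_left₀ (mul_nonneg h0 (Real.exp_pos _).le) h1 N
  have hle : ∫ t, D (φ t) * H (φ t) ^ N ∂haar ≤ Real.exp (-(σ ^ 2 / 8) * N) := by
    calc _ ≤ ∫ _t, Real.exp (-(σ ^ 2 / 8) * N) ∂haar := by
          apply integral_mono_of_nonneg _ (integrable_const _) (Eventually.of_forall hptH)
          refine Eventually.of_forall fun t => ?_
          have hx : |η * φ t| ≤ 1 := by rw [abs_mul, hηabs, one_mul]; exact hφ1 t
          have h0 := (mean_mul_exp_le hσ hσ' hs hs' hx).1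
          exact mul_nonneg (Real.exp_pos _).le (pow_nonneg h0 N)
      _ = _ := by simp
  have hpos := Real.exp_pos (-(σ ^ 2 / 8) * N)
  filter_upwards [hlim2.eventually_lt_const (u := 3 / 2 * Real.exp (-(σ ^ 2 / 8) * N))
    (by linarith)] with r hr
  refine le_trans ?_ hr.le
  have hcm : ∀ n, Measurable (cosine n) := fun n => (continuous_cosine n).measurable
  have hEm : Measurable (E r) := by
    simp only [E]
    have := hD.measurable.comp hφ
    simp only [Function.comp_def] at this
    fun_prop
  have hlc : ∀ n t, |l * cosine n t| ≤ 1 / 8 := by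
    intro n t
    simp only [l]
    rw [abs_mul, abs_mul, hηabs, abs_of_pos (by positivity : 0 < 2 * σ)]
    have := abs_cosine_le n t
    nlinarith [abs_nonneg (cosine n t)]
  have hquad : ∀ n t, Real.exp (l * cosine n t) ≤
      1 + l * cosine n t + κ * (l * cosine n t) ^ 2 := fun n t => exp_le_quadratic (hlc n t)
  have hE0 : ∀ t, 0 ≤ E r t := fun t =>
    mul_nonneg (Real.exp_pos _).le (Finset.prod_nonneg fun j _ =>
      mul_nonneg (sq_nonneg _) ((Real.exp_pos _).le.trans (hquad _ t)))
  have hEint : Integrable (E r) haar := by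
    obtain ⟨C, hC⟩ := (isCompact_Icc (a := (-1 : ℝ)) (b := 1)).exists_bound_of_continuousOn
      hD.continuousOn
    refine integrable_of_measurable_bound hEm (C := C * ∏ _j : Fin N, ((1 + s) ^ 2 * 2)) fun t => ?_
    simp only [E]
    have hC' := hC (φ t) (abs_le.1 (hφ1 t))
    rw [abs_mul, Finset.abs_prod]
    have h0 : ∀ j : Fin N, |(1 + s * φ t * cosine (10 ^ (j : ℕ) * r) t) ^ 2 *
      (1 + l * cosine (10 ^ (j : ℕ) * r) t + κ * (l * cosine (10 ^ (j : ℕ) * r) t) ^ 2)| ≤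
        (1 + s) ^ 2 * 2 := by
      intro j
      set y := cosine (10 ^ (j : ℕ) * r) t
      have hy : |y| ≤ 1 := abs_cosine_le _ t
      have hly : |l * y| ≤ 1 / 8 := hlc _ t
      rw [abs_mul, abs_pow]
      have hs0 : 0 ≤ s := hσ.le.trans hs
      have h1 : |1 + s * φ t * y| ≤ 1 + s := by
        refine (abs_add_le _ _).trans ?_
        rw [abs_one, abs_mul, abs_mul, abs_of_nonneg hs0]
        have : s * |φ t| * |y| ≤ s * 1 * 1 := by
          gcongr
          exact hφ1 t
        linarith
      have h2 : |1 + l * y + κ * (l * y) ^ 2| ≤ 2 := by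
        obtain ⟨h3, h4⟩ := abs_le.1 hly
        have h5 : 0 ≤ (l * y) ^ 2 := sq_nonneg _
        have h6 : (l * y) ^ 2 ≤ 1 / 64 := by nlinarith
        rw [abs_le]
        simp only [κ]
        constructor <;> linarith
      gcongr
    have h1 := Finset.prod_le_prod (s := Finset.univ) (fun (j : Fin N) _ => abs_nonneg _) fun j _ => h0 j
    exact mul_le_mul hC' h1 (Finset.prod_nonneg fun j _ => abs_nonneg _) ((norm_nonneg _).trans hC')
  refine integral_mono_of_nonneg (Eventually.of_forall fun t => ?_) hEint
    (Eventually.of_forall fun t => ?_)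
  · exact Set.indicator_nonneg (fun t _ => sq_nonneg _) t
  · refine Set.indicator_le' (g := E r) (fun t ht => ?_) (fun t _ => hE0 t) t
    have ht' : η * φ t + 15 / 16 < η * ((2 * σ * N)⁻¹ * ∑ j : Fin N, cosine (10 ^ (j : ℕ) * r) t) := ht
    have hexp : 1 ≤ D (φ t) * ∏ j : Fin N, Real.exp (l * cosine (10 ^ (j : ℕ) * r) t) := by
      rw [← Real.exp_sum, ← Finset.mul_sum]
      simp only [D]
      rw [← Real.exp_add]
      apply Real.one_le_exp
      set S := ∑ j : Fin N, cosine (10 ^ (j : ℕ) * r) t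
      rcases Nat.eq_zero_or_pos N with hN | hN
      · subst hN
        simp [S]
      · have hN' : (0 : ℝ) < N := by exact_mod_cast hN
        have h1 : (2 * σ * N) * (η * φ t + 15 / 16) < η * S := by
          have h2 := mul_lt_mul_of_pos_left ht' (show 0 < 2 * σ * N by positivity)
          have h3 : (2 * σ * N) * (η * ((2 * σ * N)⁻¹ * S)) = η * S := by
            field_simp
          rwa [h3] at h2
        simp only [l]
        nlinarith
    have hprod : ∏ j : Fin N, Real.exp (l * cosine (10 ^ (j : ℕ) * r) t) ≤ ∏ j : Fin N,
      (1 + l * cosine (10 ^ (j : ℕ) * r) t + κ * (l * cosine (10 ^ (j : ℕ) * r) t) ^ 2) :=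
      Finset.prod_le_prod (fun _ _ => (Real.exp_pos _).le) fun j _ => hquad _ t
    simp only [E]
    rw [Finset.prod_mul_distrib, Finset.prod_pow, mul_left_comm]
    refine le_mul_of_one_le_right (sq_nonneg _) (hexp.trans ?_)
    exact mul_le_mul_of_nonneg_left hprod (Real.exp_pos _).le

end

/-- The average of `N` lacunary cosines of base frequency `r`, amplified by `1 / (2σ)`. -/
noncomputable def cosAvg (σ : ℝ) (N r : ℕ) (t : Circ) : ℝ :=
  (2 * σ * N)⁻¹ * ∑ j : Fin N, cosine (10 ^ (j : ℕ) * r) t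

theorem continuous_cosAvg (σ : ℝ) (N r : ℕ) : Continuous (cosAvg σ N r) :=
  continuous_const.mul (continuous_finsetSum _ fun _ _ => continuous_cosine _)

section
variable {q : ENNReal} [Fact (1 ≤ q)] [Fact (2 ≤ q)] {φ : Circ → ℝ}

theorem eventually_norm_fc_bad_le (hq : q ≠ ⊤)
    (hφ : Measurable φ) (hφ1 : ∀ t, |φ t| ≤ 1) {B : Circ → ℝ} (hB : Measurable B) {β : ℝ}
    (hBβ : ∀ t, |B t| ≤ β) (N : ℕ)
    {σ s : ℝ} (hσ : 0 < σ) (hσ' : σ ≤ 1 / 16) (hs : σ ≤ s) (hs' : s ≤ 2 * σ) :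
    ∀ᶠ r : ℕ in atTop, ‖fc q (fun t => ((B t * Set.indicator {t | 15 / 16 < |φ t - cosAvg σ N r t|}
      (fun t => ∏ j : Fin N, (1 + s * φ t * cosine (10 ^ (j : ℕ) * r) t)) t : ℝ) : ℂ))‖ ≤
      2 * β * Real.exp (-(σ ^ 2 / 16) * N) := by
  have hβ : 0 ≤ β := (abs_nonneg _).trans (hBβ 0)
  filter_upwards [eventually_integral_riesz_sq_le hφ hφ1 N hσ hσ' hs hs' (Or.inl rfl),
    eventually_integral_riesz_sq_le hφ hφ1 N hσ hσ' hs hs' (Or.inr rfl)] with r h1 h2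
  set R : Circ → ℝ := fun t => ∏ j : Fin N, (1 + s * φ t * cosine (10 ^ (j : ℕ) * r) t)
  have hX : Measurable (cosAvg σ N r) := (continuous_cosAvg σ N r).measurable
  have hcm : ∀ n, Measurable (cosine n) := fun n => (continuous_cosine n).measurable
  have hPm : Measurable R := by
    simp only [R]
    fun_prop
  have hs0 : 0 ≤ s := hσ.le.trans hs
  have hPb : ∀ t, |R t| ≤ (1 + s) ^ N := by
    intro t
    simp only [R]
    rw [Finset.abs_prod]
    refine (Finset.prod_le_prod (fun _ _ => abs_nonneg _) fun j _ => ?_).trans_eq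
      (by simp : ∏ _j : Fin N, (1 + s) = (1 + s) ^ N)
    refine (abs_add_le _ _).trans ?_
    rw [abs_one, abs_mul, abs_mul, abs_of_nonneg hs0]
    have : s * |φ t| * |cosine (10 ^ (j : ℕ) * r) t| ≤ s * 1 * 1 := by
      gcongr
      exacts [hφ1 t, abs_cosine_le _ t]
    linarith
  set S : Set Circ := {t | 15 / 16 < |φ t - cosAvg σ N r t|}
  have hS : MeasurableSet S := measurableSet_lt measurable_const (hφ.sub hX).abs
  have hSP : Measurable (S.indicator R) := hPm.indicator hS
  have hSPb : ∀ t, |S.indicator R t| ≤ (1 + s) ^ N := by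
    intro t
    by_cases ht : t ∈ S
    · rw [Set.indicator_of_mem ht]; exact hPb t
    · rw [Set.indicator_of_notMem ht, abs_zero]; positivity
  have hmem : MemLp (fun t => ((B t * S.indicator R t : ℝ) : ℂ)) 2 haar := by
    refine memLp_of_bound (β := β * (1 + s) ^ N) (measurable_ofReal.comp (hB.mul hSP)) fun t => ?_
    rw [Complex.norm_real, Real.norm_eq_abs, abs_mul]
    exact mul_le_mul (hBβ t) (hSPb t) (abs_nonneg _) hβ
  set T : ℝ → Set Circ := fun η => {t | η * φ t + 15 / 16 <
        η * ((2 * σ * N)⁻¹ * ∑ j : Fin N, cosine (10 ^ (j : ℕ) * r) t)}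
  have hT : ∀ η, MeasurableSet (T η) := fun η =>
    measurableSet_lt ((hφ.const_mul _).add_const _) (hX.const_mul η)
  have hTint : ∀ η, Integrable ((T η).indicator fun t => R t ^ 2) haar := by
    intro η
    refine integrable_of_measurable_bound ((hPm.pow_const 2).indicator (hT η))
      (C := ((1 + s) ^ N) ^ 2) fun t => ?_
    by_cases ht : t ∈ T η
    · rw [Set.indicator_of_mem ht, abs_pow]
      exact pow_le_pow_left₀ (abs_nonneg _) (hPb t) 2
    · rw [Set.indicator_of_notMem ht, abs_zero]; positivity
  have key : ‖fc q (fun t => ((B t * S.indicator R t : ℝ) : ℂ))‖ ^ 2 ≤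
      (2 * β * Real.exp (-(σ ^ 2 / 16) * N)) ^ 2 := by
    calc _ ≤ ∫ t, ‖((B t * S.indicator R t : ℝ) : ℂ)‖ ^ 2 ∂haar := norm_fc_sq_le hq hmem
      _ ≤ ∫ t, β ^ 2 * ((T 1).indicator (fun t => R t ^ 2) t +
            (T (-1)).indicator (fun t => R t ^ 2) t) ∂haar := by
          refine integral_mono_of_nonneg (Eventually.of_forall fun t => by positivity)
            (((hTint 1).add (hTint (-1))).const_mul _) (Eventually.of_forall fun t => ?_)
          simp only
          rw [Complex.norm_real, Real.norm_eq_abs, sq_abs, mul_pow, ← sq_abs (B t)]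
          have hnn : ∀ η, 0 ≤ (T η).indicator (fun t => R t ^ 2) t := fun η =>
            Set.indicator_nonneg (fun _ _ => sq_nonneg _) t
          refine mul_le_mul (pow_le_pow_left₀ (abs_nonneg _) (hBβ t) 2) ?_ (sq_nonneg _)
            (sq_nonneg _)
          by_cases ht : t ∈ S
          · rw [Set.indicator_of_mem ht]
            rcases lt_abs.1 (show 15 / 16 < |φ t - cosAvg σ N r t| from ht) with h | h
            · have : t ∈ T (-1) := by
                change -1 * φ t + 15 / 16 < -1 * cosAvg σ N r t
                linarith
              rw [Set.indicator_of_mem this]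
              linarith [hnn 1]
            · have : t ∈ T 1 := by
                change 1 * φ t + 15 / 16 < 1 * cosAvg σ N r t
                linarith
              rw [Set.indicator_of_mem this]
              linarith [hnn (-1)]
          · rw [Set.indicator_of_notMem ht]
            have := hnn 1
            have := hnn (-1)
            nlinarith
      _ ≤ β ^ 2 * (3 / 2 * Real.exp (-(σ ^ 2 / 8) * N) + 3 / 2 * Real.exp (-(σ ^ 2 / 8) * N)) := by
          rw [integral_const_mul, integral_add (hTint 1) (hTint (-1))]
          exact mul_le_mul_of_nonneg_left (add_le_add h1 h2) (sq_nonneg _)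
      _ ≤ _ := by
          have : Real.exp (-(σ ^ 2 / 8) * N) = Real.exp (-(σ ^ 2 / 16) * N) ^ 2 := by
            rw [← Real.exp_nat_mul]; congr 1; push_cast; ring
          rw [this, mul_pow, mul_pow]
          nlinarith [mul_nonneg (sq_nonneg β) (sq_nonneg (Real.exp (-(σ ^ 2 / 16) * N)))]
  exact le_of_sq_le_sq key (by positivity)

theorem eventually_exists_modification (hq : q ≠ ⊤)
    (hφ : Measurable φ) (hφ1 : ∀ t, |φ t| ≤ 1) {B : Circ → ℝ} (hB : Measurable B) {β : ℝ}
    (hBβ : ∀ t, |B t| ≤ β) {M : ℕ} (hM : 1 ≤ M) {σ : ℝ} (hσ : 0 < σ) (hσ' : σ ≤ 1 / 16)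
    (N : ℕ) {L A : ℝ} (hL : 1 ≤ L) (hA : 0 ≤ A)
    (hLA : (β * 17 ^ M) ^ q.toReal * (L ^ M)⁻¹ * (1 + 2 * (L * σ ^ q.toReal)) ^ N ≤ A ^ q.toReal)
    {ε : ℝ} (hε : 0 < ε) :
    ∀ᶠ r : ℕ in atTop, ∃ B' : Circ → ℝ, Measurable B' ∧ (∃ β', ∀ t, |B' t| ≤ β') ∧
      (∀ t, B' t ≠ 0 → B t ≠ 0 ∧ |φ t - cosAvg σ N r t| ≤ 15 / 16) ∧
      ‖fc q (fun t => (B' t : ℂ)) - fc q (fun t => (B t : ℂ))‖ ≤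
        A + ε + 17 ^ M * (2 * β * Real.exp (-(σ ^ 2 / 16) * N)) := by
  obtain ⟨w, s, hs, hw, hw1, hw0⟩ := exists_weights hM hσ
  have hβ : 0 ≤ β := (abs_nonneg _).trans (hBβ 0)
  have hbad := (eventually_all_finset (Finset.range (M + 1))).2 fun i hi =>
    eventually_norm_fc_bad_le hq hφ hφ1 hB hBβ N hσ hσ' (hs i hi).1 (hs i hi).2
  filter_upwards [hbad,
    eventually_norm_fc_riesz_sub_le hq hφ hφ1 hB hBβ hσ hs hw hw1 hw0 N hL hA hLA hε] with r h1 h2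
  set R : ℕ → Circ → ℝ := fun i t => ∏ j : Fin N, (1 + s i * φ t * cosine (10 ^ (j : ℕ) * r) t)
  set S : Set Circ := {t | 15 / 16 < |φ t - cosAvg σ N r t|}
  have hX : Measurable (cosAvg σ N r) := (continuous_cosAvg σ N r).measurable
  have hcm : ∀ n, Measurable (cosine n) := fun n => (continuous_cosine n).measurable
  have hPm : ∀ i, Measurable (R i) := by
    intro i
    simp only [R]
    fun_prop
  have hPb : ∀ i, ∀ t, |R i t| ≤ (1 + |s i|) ^ N := by
    intro i t
    simp only [R]
    rw [Finset.abs_prod]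
    refine (Finset.prod_le_prod (fun _ _ => abs_nonneg _) fun j _ => ?_).trans_eq
      (by simp : ∏ _j : Fin N, (1 + |s i|) = (1 + |s i|) ^ N)
    refine (abs_add_le _ _).trans ?_
    rw [abs_one, abs_mul, abs_mul]
    have : |s i| * |φ t| * |cosine (10 ^ (j : ℕ) * r) t| ≤ |s i| * 1 * 1 := by
      gcongr
      exacts [hφ1 t, abs_cosine_le _ t]
    linarith
  have hS : MeasurableSet S := measurableSet_lt measurable_const (hφ.sub hX).abs
  set G : Circ → ℝ := fun t => ∑ i ∈ Finset.range (M + 1), w i * R i t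
  have hGm : Measurable G := Finset.measurable_fun_sum _ fun i _ => (hPm i).const_mul _
  set CG : ℝ := ∑ i ∈ Finset.range (M + 1), |w i| * (1 + |s i|) ^ N
  have hGb : ∀ t, |G t| ≤ CG := fun t => by
    refine (Finset.abs_sum_le_sum_abs _ _).trans (Finset.sum_le_sum fun i _ => ?_)
    rw [abs_mul]
    exact mul_le_mul_of_nonneg_left (hPb i t) (abs_nonneg _)
  have hBG : ∀ t, |B t * G t| ≤ β * CG := fun t => by
    rw [abs_mul]; exact mul_le_mul (hBβ t) (hGb t) (abs_nonneg _) hβ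
  have hBGmem : MemLp (fun t => ((B t * G t : ℝ) : ℂ)) 2 haar :=
    memLp_of_bound (measurable_ofReal.comp (hB.mul hGm)) fun t => by
      rw [Complex.norm_real]; exact hBG t
  have hbmem : ∀ i, MemLp (fun t => ((B t * S.indicator (R i) t : ℝ) : ℂ)) 2 haar := fun i => by
    refine memLp_of_bound (β := β * (1 + |s i|) ^ N)
      (measurable_ofReal.comp (hB.mul ((hPm i).indicator hS))) fun t => ?_
    rw [Complex.norm_real, Real.norm_eq_abs, abs_mul]
    refine mul_le_mul (hBβ t) ?_ (abs_nonneg _) hβ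
    by_cases ht : t ∈ S
    · rw [Set.indicator_of_mem ht]; exact hPb i t
    · rw [Set.indicator_of_notMem ht, abs_zero]; positivity
  refine ⟨Sᶜ.indicator fun t => B t * G t, (hB.mul hGm).indicator hS.compl, ⟨β * CG, fun t => ?_⟩,
    fun t ht => ?_, ?_⟩
  · by_cases ht : t ∈ Sᶜ
    · rw [Set.indicator_of_mem ht]; exact hBG t
    · rw [Set.indicator_of_notMem ht, abs_zero]; exact (abs_nonneg _).trans (hBG t)
  · have hmem : t ∈ Sᶜ := Set.mem_of_indicator_ne_zero ht
    rw [Set.indicator_of_mem hmem] at ht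
    exact ⟨left_ne_zero_of_mul ht, not_lt.1 hmem⟩
  · have hdec : (fun t => ((Sᶜ.indicator (fun t => B t * G t) t : ℝ) : ℂ)) = fun t =>
        ((B t * G t : ℝ) : ℂ) - ∑ i ∈ Finset.range (M + 1),
          (w i : ℂ) * ((B t * S.indicator (R i) t : ℝ) : ℂ) := by
      funext t
      by_cases ht : t ∈ S
      · rw [Set.indicator_of_notMem (not_not.2 ht)]
        simp only [Set.indicator_of_mem ht, G]
        push_cast
        rw [Finset.mul_sum, eq_comm, sub_eq_zero]
        exact Finset.sum_congr rfl fun i _ => by ring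
      · rw [Set.indicator_of_mem (show t ∈ Sᶜ from ht)]
        simp [Set.indicator_of_notMem ht]
    have hwmem : ∀ i ∈ Finset.range (M + 1), MemLp (fun t =>
        (w i : ℂ) * ((B t * S.indicator (R i) t : ℝ) : ℂ)) 2 haar := fun i _ => (hbmem i).const_mul _
    rw [hdec, fc_sub hBGmem (memLp_finsetSum _ hwmem), fc_sum _ _ hwmem, sub_right_comm]
    refine (norm_sub_le _ _).trans (add_le_add h2 ?_)
    refine (norm_sum_le _ _).trans ?_
    calc _ ≤ ∑ i ∈ Finset.range (M + 1), |w i| * (2 * β * Real.exp (-(σ ^ 2 / 16) * N)) := by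
          refine Finset.sum_le_sum fun i hi => ?_
          rw [fc_const_mul (hbmem i), norm_smul, Complex.norm_real, Real.norm_eq_abs]
          exact mul_le_mul_of_nonneg_left (h1 i hi) (abs_nonneg _)
      _ ≤ _ := by
          rw [← Finset.sum_mul]
          exact mul_le_mul_of_nonneg_right hw (by positivity)

theorem exists_modification (hq : q ≠ ⊤) (hq2 : 2 < q) : ∃ σ : ℝ, 0 < σ ∧ σ ≤ 1 / 16 ∧
    ∀ (φ : Circ → ℝ), Measurable φ → (∀ t, |φ t| ≤ 1) → ∀ (B : Circ → ℝ), Measurable B →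
    ∀ (β : ℝ), (∀ t, |B t| ≤ β) → ∀ (ε : ℝ), 0 < ε → ∀ N₀ : ℕ, ∃ N r : ℕ, N₀ ≤ N ∧ 1 ≤ N ∧ 1 ≤ r ∧
    ∃ B' : Circ → ℝ, Measurable B' ∧ (∃ β', ∀ t, |B' t| ≤ β') ∧
      (∀ t, B' t ≠ 0 → B t ≠ 0 ∧ |φ t - cosAvg σ N r t| ≤ 15 / 16) ∧
      ‖fc q (fun t => (B' t : ℂ)) - fc q (fun t => (B t : ℂ))‖ ≤ ε := by
  set Q := q.toReal
  have hQ : 2 < Q := by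
    have := (ENNReal.toReal_lt_toReal (by norm_num) hq).2 hq2
    simpa using this
  set L : ℝ := 6 * 17 ^ Q
  have h17 : (1 : ℝ) ≤ 17 ^ Q := Real.one_le_rpow (by norm_num) (by linarith)
  have hL : 1 ≤ L := by simp only [L]; linarith
  have hL0 : 0 < L := by linarith
  set τ : ℝ := (1 / (130 * L)) ^ (1 / (Q - 2))
  have hτ : 0 < τ := Real.rpow_pos_of_pos (by positivity) _
  set σ : ℝ := min (1 / 16) τ
  have hσ : 0 < σ := lt_min (by norm_num) hτ
  have hσ' : σ ≤ 1 / 16 := min_le_left _ _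
  have hσL : 130 * L * σ ^ (Q - 2) ≤ 1 := by
    have : σ ^ (Q - 2) ≤ τ ^ (Q - 2) :=
      Real.rpow_le_rpow hσ.le (min_le_right _ _) (by linarith)
    have h2 : τ ^ (Q - 2) = 1 / (130 * L) := by
      simp only [τ]
      rw [← Real.rpow_mul (by positivity), one_div_mul_cancel (by linarith), Real.rpow_one]
    rw [h2, le_div_iff₀ (by positivity)] at this
    linarith
  refine ⟨σ, hσ, hσ', ?_⟩
  intro φ hφ hφ1 B hB β hBβ ε hε N₀
  have hβ : 0 ≤ β := (abs_nonneg _).trans (hBβ 0)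
  have hlim1 : Tendsto (fun M : ℕ => β ^ Q * (1 / 2 : ℝ) ^ M) atTop (𝓝 0) := by
    simpa using (tendsto_pow_atTop_nhds_zero_of_lt_one (r := (1 / 2 : ℝ)) (by norm_num)
      (by norm_num)).const_mul (β ^ Q)
  have hlim2 : Tendsto (fun M : ℕ => 2 * β * (1 / 2 : ℝ) ^ M) atTop (𝓝 0) := by
    simpa using (tendsto_pow_atTop_nhds_zero_of_lt_one (r := (1 / 2 : ℝ)) (by norm_num)
      (by norm_num)).const_mul (2 * β)
  obtain ⟨M, hM1, hM2, hM3⟩ := ((hlim1.eventually_lt_const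
    (Real.rpow_pos_of_pos (by linarith : 0 < ε / 3) Q)).and
    ((hlim2.eventually_lt_const (by linarith : 0 < ε / 3)).and (eventually_ge_atTop (N₀ + 1)))).exists
  have hM : 1 ≤ M := by omega
  have hMR : (1 : ℝ) ≤ M := by exact_mod_cast hM
  set N : ℕ := ⌈64 * M / σ ^ 2⌉₊
  have hσ2 : 0 < σ ^ 2 := by positivity
  have hσ21 : σ ^ 2 ≤ 1 := by nlinarith
  have hN1 : 64 * M / σ ^ 2 ≤ N := Nat.le_ceil _
  have hN2 : (N : ℝ) ≤ 65 * M / σ ^ 2 := by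
    have h1 := (Nat.ceil_lt_add_one (show 0 ≤ 64 * M / σ ^ 2 by positivity)).le
    have h2 : 1 ≤ M / σ ^ 2 := (one_le_div hσ2).2 (by linarith)
    calc (N : ℝ) ≤ 64 * M / σ ^ 2 + 1 := h1
      _ ≤ 64 * M / σ ^ 2 + M / σ ^ 2 := by linarith
      _ = _ := by ring
  have hNM : M ≤ N := by
    have : (M : ℝ) ≤ N := by
      refine le_trans ?_ hN1
      rw [le_div_iff₀ hσ2]
      nlinarith
    exact_mod_cast this
  have hLA : (β * 17 ^ M) ^ Q * (L ^ M)⁻¹ * (1 + 2 * (L * σ ^ Q)) ^ N ≤ (ε / 3) ^ Q := by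
    have h1 : (1 + 2 * (L * σ ^ Q)) ^ N ≤ Real.exp 1 ^ M := by
      calc (1 + 2 * (L * σ ^ Q)) ^ N ≤ Real.exp (2 * (L * σ ^ Q)) ^ N := by
            refine pow_le_pow_left₀ (by positivity) ?_ _
            rw [add_comm]; exact Real.add_one_le_exp _
        _ = Real.exp (N * (2 * (L * σ ^ Q))) := by rw [Real.exp_nat_mul]
        _ ≤ Real.exp (M * 1) := by
            apply Real.exp_le_exp.2
            have h3 : σ ^ Q = σ ^ (Q - 2) * σ ^ 2 := by
              rw [← Real.rpow_natCast σ 2, ← Real.rpow_add hσ]; congr 1; push_cast; ring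
            calc (N : ℝ) * (2 * (L * σ ^ Q)) ≤ 65 * M / σ ^ 2 * (2 * (L * σ ^ Q)) := by gcongr
              _ = 130 * L * σ ^ (Q - 2) * M := by rw [h3]; field_simp; ring
              _ ≤ 1 * M := by gcongr
              _ = _ := by ring
        _ = _ := by rw [Real.exp_nat_mul]
    have h2 : (β * 17 ^ M) ^ Q = β ^ Q * (17 ^ Q) ^ M := by
      rw [Real.mul_rpow hβ (by positivity), ← Real.rpow_natCast, ← Real.rpow_natCast,
        ← Real.rpow_mul (by norm_num), ← Real.rpow_mul (by norm_num), mul_comm Q]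
    have h3 : (17 ^ Q) ^ M * (L ^ M)⁻¹ * Real.exp 1 ^ M ≤ (1 / 2 : ℝ) ^ M := by
      rw [← inv_pow, ← mul_pow, ← mul_pow]
      refine pow_le_pow_left₀ (by positivity) ?_ _
      have h4 : (17 : ℝ) ^ Q * L⁻¹ = 1 / 6 := by simp only [L]; field_simp
      rw [h4]
      linarith [Real.exp_one_lt_d9]
    calc _ ≤ (β * 17 ^ M) ^ Q * (L ^ M)⁻¹ * Real.exp 1 ^ M := by gcongr
      _ = β ^ Q * ((17 ^ Q) ^ M * (L ^ M)⁻¹ * Real.exp 1 ^ M) := by rw [h2]; ring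
      _ ≤ β ^ Q * (1 / 2 : ℝ) ^ M := by gcongr
      _ ≤ _ := hM1.le
  have hE : 17 ^ M * (2 * β * Real.exp (-(σ ^ 2 / 16) * N)) ≤ ε / 3 := by
    have h1 : Real.exp (-(σ ^ 2 / 16) * N) ≤ Real.exp (-4) ^ M := by
      rw [← Real.exp_nat_mul]
      apply Real.exp_le_exp.2
      rw [div_le_iff₀ hσ2] at hN1
      linarith
    have h2 : 17 * Real.exp (-4) ≤ 1 / 2 := by
      have h3 : (2.7 : ℝ) ^ 4 ≤ Real.exp 1 ^ 4 :=
        pow_le_pow_left₀ (by norm_num) (by linarith [Real.exp_one_gt_d9]) 4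
      rw [← Real.exp_nat_mul] at h3
      rw [Real.exp_neg, ← div_eq_mul_inv, div_le_iff₀ (Real.exp_pos _)]
      norm_num at h3 ⊢
      linarith
    calc _ ≤ 17 ^ M * (2 * β * Real.exp (-4) ^ M) := by gcongr
      _ = 2 * β * (17 * Real.exp (-4)) ^ M := by rw [mul_pow]; ring
      _ ≤ 2 * β * (1 / 2) ^ M := by
          gcongr
      _ ≤ _ := hM2.le
  obtain ⟨r, ⟨B', h1, h2, h3, h4⟩, hr⟩ := ((eventually_exists_modification hq hφ hφ1 hB hBβ hM hσ hσ'
    N hL (by positivity) hLA (by linarith : 0 < ε / 3)).and (eventually_ge_atTop 1)).exists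
  exact ⟨N, r, by omega, by omega, hr, B', h1, h2, h3, h4.trans (by linarith)⟩

end

/-- The trigonometric polynomial with coefficients `f`. -/
noncomputable def trigPoly (f : ℤ →₀ ℂ) (t : Circ) : ℂ :=
  Finsupp.linearCombination ℂ (fun n : ℤ => (fourier n t : ℂ)) f

/-- The function on the circle with absolutely summable Fourier coefficients `v`. -/
noncomputable def hat (v : Seq 1) (t : Circ) : ℂ := ∑' k : ℤ, v k * fourier k t

theorem norm_fourier_apply (n : ℤ) (t : Circ) : ‖(fourier n t : ℂ)‖ = 1 := by
  rw [fourier_apply, Circle.norm_coe]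

theorem summable_norm_seq (v : Seq 1) : Summable fun k => ‖v k‖ := by
  simpa using (lp.memℓp v).summable (by simp)

theorem norm_seq_eq (v : Seq 1) : ‖v‖ = ∑' k, ‖v k‖ := by
  simpa using lp.norm_eq_tsum_rpow (p := 1) (by simp) v

theorem summable_hat (v : Seq 1) (t : Circ) : Summable fun k : ℤ => v k * (fourier k t : ℂ) :=
  Summable.of_norm (by simpa only [norm_mul, norm_fourier_apply, mul_one] using summable_norm_seq v)

theorem norm_hat_le (v : Seq 1) (t : Circ) : ‖hat v t‖ ≤ ‖v‖ := by
  rw [norm_seq_eq]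
  refine (norm_tsum_le_tsum_norm ?_).trans_eq ?_ <;>
    simp only [norm_mul, norm_fourier_apply, mul_one]
  exact summable_norm_seq v

theorem hat_sub (v w : Seq 1) (t : Circ) : hat (v - w) t = hat v t - hat w t := by
  rw [hat, hat, hat, ← (summable_hat v t).tsum_sub (summable_hat w t)]
  simp [sub_mul]

theorem continuous_hat (v : Seq 1) : Continuous (hat v) := by
  refine continuous_tsum (u := fun k => ‖v k‖) (fun k => by fun_prop) (summable_norm_seq v) fun k t => ?_
  rw [norm_mul, norm_fourier_apply, mul_one]

theorem hat_emb (f : ℤ →₀ ℂ) (t : Circ) : hat (emb 1 f) t = trigPoly f t := by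
  rw [hat, trigPoly, Finsupp.linearCombination_apply, Finsupp.sum, tsum_eq_sum (s := f.support)]
  · simp
  · intro k hk
    simp [Finsupp.notMem_support_iff.1 hk]

theorem norm_sum_e_le {p : ENNReal} [Fact (1 ≤ p)] (hp : p ≠ ⊤) {N : ℕ} {g : Fin N → ℤ}
    (hg : Function.Injective g) : ‖∑ j, e p (g j)‖ ≤ (N : ℝ) ^ (1 / p.toReal) := by
  have hp0 : 0 < p.toReal := ENNReal.toReal_pos (lt_of_lt_of_le one_pos (Fact.out : 1 ≤ p)).ne' hp
  have h := lp.norm_sum_single (E := fun _ : ℤ => ℂ) hp0 (fun _ => 1) (Finset.univ.image g)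
  rw [Finset.sum_image hg.injOn] at h
  have h2 : ‖∑ j, e p (g j)‖ ^ p.toReal = N := by
    refine h.trans ?_
    simp [Finset.card_image_of_injective _ hg]
  rw [← h2, ← Real.rpow_mul (norm_nonneg _), mul_one_div_cancel hp0.ne', Real.rpow_one]

/-- The Fourier coefficients of `cosAvg`. -/
noncomputable def cosAvgCoeff (σ : ℝ) (N r : ℕ) : ℤ →₀ ℂ :=
  ((((2 * σ * N)⁻¹ / 2 : ℝ)) : ℂ) • ∑ j : Fin N, (Finsupp.single ((10 : ℤ) ^ (j : ℕ) * r) 1 +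
    Finsupp.single (-((10 : ℤ) ^ (j : ℕ) * r)) 1)

theorem trigPoly_cosAvgCoeff (σ : ℝ) (N r : ℕ) (t : Circ) :
    trigPoly (cosAvgCoeff σ N r) t = cosAvg σ N r t := by
  simp only [trigPoly, cosAvgCoeff, map_smul, map_sum, map_add, Finsupp.linearCombination_single,
    cosAvg, Complex.ofReal_mul, Complex.ofReal_sum, cosine_eq, smul_eq_mul,
    Complex.ofReal_div]
  rw [Finset.mul_sum, Finset.mul_sum]
  refine Finset.sum_congr rfl fun j _ => ?_
  push_cast
  ring

theorem cosAvgCoeff_zero (σ : ℝ) (N : ℕ) {r : ℕ} (hr : 1 ≤ r) : cosAvgCoeff σ N r 0 = 0 := by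
  have : r ≠ 0 := by omega
  simp [cosAvgCoeff, this]

theorem norm_emb_cosAvgCoeff_le {p : ENNReal} [Fact (1 ≤ p)] (hp : p ≠ ⊤) {σ : ℝ} (hσ : 0 < σ)
    (N : ℕ) {r : ℕ} (hr : 1 ≤ r) :
    ‖emb p (cosAvgCoeff σ N r)‖ ≤ (2 * σ * N)⁻¹ * (N : ℝ) ^ (1 / p.toReal) := by
  have hr0 : (r : ℤ) ≠ 0 := by omega
  have hinj : Function.Injective fun j : Fin N => (10 : ℤ) ^ (j : ℕ) * r := by
    intro a b h
    have := mul_right_cancel₀ hr0 h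
    exact Fin.ext (Int.pow_right_injective (by norm_num) this)
  have h1 := norm_sum_e_le (p := p) hp hinj
  have h2 := norm_sum_e_le (p := p) hp (g := fun j : Fin N => -((10 : ℤ) ^ (j : ℕ) * r))
    fun a b h => hinj (neg_injective h)
  simp only [cosAvgCoeff, map_smul, map_sum, map_add, emb_single, one_smul]
  rw [norm_smul, Finset.sum_add_distrib, Complex.norm_real, Real.norm_eq_abs,
    abs_of_nonneg (by positivity)]
  have h3 := (norm_add_le (∑ j : Fin N, e p ((10 : ℤ) ^ (j : ℕ) * r))
    (∑ j : Fin N, e p (-((10 : ℤ) ^ (j : ℕ) * r)))).trans (add_le_add h1 h2)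
  calc _ ≤ (2 * σ * N)⁻¹ / 2 * ((N : ℝ) ^ (1 / p.toReal) + (N : ℝ) ^ (1 / p.toReal)) := by gcongr
    _ = _ := by ring

theorem exists_tendsto_dist_le {E : Type*} [PseudoMetricSpace E] [CompleteSpace E]
    {u : ℕ → E} {δ : ℕ → ℝ}
    (hu : ∀ n, dist (u n) (u (n + 1)) ≤ δ n / 2) (hδ : ∀ n, δ (n + 1) ≤ δ n / 2) :
    ∃ v, Tendsto u atTop (𝓝 v) ∧ ∀ n, dist v (u n) ≤ δ n := by
  have hg : ∀ n m, δ (n + m) ≤ δ n / 2 ^ m := by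
    intro n m
    induction m with
    | zero => simp
    | succ m ih =>
      refine (hδ (n + m)).trans ?_
      rw [pow_succ, ← div_div]
      linarith
  have hd : ∀ n, ∀ m, dist (u (n + m)) (u (n + (m + 1))) ≤ δ n / 2 / 2 ^ m := by
    intro n m
    refine (hu (n + m)).trans ?_
    rw [div_right_comm]
    linarith [hg n m]
  have hc := cauchySeq_of_le_geometric_two (f := u) (C := δ 0) fun m => by simpa using hd 0 m
  obtain ⟨v, hv⟩ := cauchySeq_tendsto_of_complete hc
  refine ⟨v, hv, fun n => ?_⟩
  rw [dist_comm]
  have := dist_le_of_le_geometric_two_of_tendsto₀ (f := fun m => u (n + m)) (C := δ n) (hd n)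
    (a := v) ((tendsto_add_atTop_iff_nat n).2 hv |>.congr fun m => by rw [add_comm])
  simpa using this

/-- An approximation of the cyclic vector by a trigonometric polynomial (`coeff`, `poly`), together
with an approximation `B` of the annihilating functional and an admissible error `δ`. -/
structure Approximant (p : ENNReal) [Fact (1 ≤ p)] (n : ℕ) where
  coeff : ℤ →₀ ℂ
  poly : Circ → ℝ
  B : Circ → ℝ
  β : ℝ
  δ : ℝ
  coeff_zero : coeff 0 = 1
  trigPoly_coeff : ∀ t, trigPoly coeff t = poly t
  measurable_poly : Measurable poly
  measurable_B : Measurable B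
  abs_B_le : ∀ t, |B t| ≤ β
  poly_le : ∀ t, B t ≠ 0 → |poly t| ≤ (15 / 16) ^ n
  δ_pos : 0 < δ
  closedBall_subset : Metric.closedBall (emb p coeff) δ ⊆ nearCyclic p (1 / ((n : ℝ) + 1))

section
variable {p q : ENNReal} [Fact (1 ≤ p)] [Fact (2 ≤ q)]

theorem exists_closedBall_subset (hp1 : 1 < p) (hp : p ≠ ⊤) {f : ℤ →₀ ℂ} (hf : f 0 = 1) (n : ℕ)
    {η : ℝ} (hη : 0 < η) :
    ∃ δ > 0, δ ≤ η ∧ Metric.closedBall (emb p f) δ ⊆ nearCyclic p (1 / ((n : ℝ) + 1)) := by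
  have hf0 : f ≠ 0 := fun h => by simp [h] at hf
  have hmem := emb_mem_nearCyclic hp1 hp f hf0 (ε := 1 / ((n : ℝ) + 1)) (by positivity)
  obtain ⟨δ, hδ, hsub⟩ := Metric.nhds_basis_closedBall.mem_iff.1
    ((isOpen_nearCyclic (p := p) _).mem_nhds hmem)
  exact ⟨min δ η, lt_min hδ hη, min_le_right _ _,
    (Metric.closedBall_subset_closedBall (min_le_left _ _)).trans hsub⟩

theorem exists_approximant_zero (hp1 : 1 < p) (hp : p ≠ ⊤) :
    ∃ S : Approximant p 0, S.δ ≤ 1 / 2 ∧ ∀ t, S.B t = 1 := by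
  obtain ⟨δ, hδ, hδ', hsub⟩ := exists_closedBall_subset hp1 hp (f := Finsupp.single 0 1) (by simp) 0
    (η := 1 / 2) (by norm_num)
  exact ⟨{
    coeff := Finsupp.single 0 1
    poly := fun _ => 1
    B := fun _ => 1
    β := 1
    δ := δ
    coeff_zero := by simp
    trigPoly_coeff := by simp [trigPoly]
    measurable_poly := measurable_const
    measurable_B := measurable_const
    abs_B_le := by simp
    poly_le := by simp
    δ_pos := hδ
    closedBall_subset := hsub }, hδ', fun _ => rfl⟩

theorem exists_approximant_succ (hp1 : 1 < p) (hp : p ≠ ⊤) {σ : ℝ} (hσ : 0 < σ)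
    (H : ∀ (φ : Circ → ℝ), Measurable φ → (∀ t, |φ t| ≤ 1) → ∀ (B : Circ → ℝ), Measurable B →
      ∀ (β : ℝ), (∀ t, |B t| ≤ β) → ∀ (ε : ℝ), 0 < ε → ∀ N₀ : ℕ,
      ∃ N r : ℕ, N₀ ≤ N ∧ 1 ≤ N ∧ 1 ≤ r ∧
      ∃ B' : Circ → ℝ, Measurable B' ∧ (∃ β', ∀ t, |B' t| ≤ β') ∧
        (∀ t, B' t ≠ 0 → B t ≠ 0 ∧ |φ t - cosAvg σ N r t| ≤ 15 / 16) ∧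
        ‖fc q (fun t => (B' t : ℂ)) - fc q (fun t => (B t : ℂ))‖ ≤ ε)
    (n : ℕ) (S : Approximant p n) :
    ∃ S' : Approximant p (n + 1), S'.δ ≤ S.δ / 2 ∧
      ‖emb 1 S'.coeff - emb 1 S.coeff‖ ≤ (2 * σ)⁻¹ * (15 / 16) ^ n ∧
      ‖emb p S'.coeff - emb p S.coeff‖ ≤ S.δ / 2 ∧
      ‖fc q (fun t => (S'.B t : ℂ)) - fc q (fun t => (S.B t : ℂ))‖ ≤ S.δ / 2 := by
  set ρ : ℝ := (15 / 16) ^ n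
  have hρ : 0 < ρ := by positivity
  have hρ1 : ρ ≤ 1 := pow_le_one₀ (by norm_num) (by norm_num)
  set ψ : Circ → ℝ := fun t => max (-1) (min 1 (ρ⁻¹ * S.poly t))
  have hψm : Measurable ψ :=
    measurable_const.max (measurable_const.min (S.measurable_poly.const_mul _))
  have hψ1 : ∀ t, |ψ t| ≤ 1 := fun t =>
    abs_le.2 ⟨le_max_left _ _, max_le (by norm_num) (min_le_left _ _)⟩
  have hψ : ∀ t, S.B t ≠ 0 → ρ * ψ t = S.poly t := by
    intro t ht
    have h1 := abs_le.1 (S.poly_le t ht)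
    have h2 : |ρ⁻¹ * S.poly t| ≤ 1 := by
      rw [abs_mul, abs_of_pos (inv_pos.2 hρ), inv_mul_le_iff₀ hρ, mul_one]
      exact S.poly_le t ht
    rw [abs_le] at h2
    simp only [ψ]
    rw [min_eq_right h2.2, max_eq_right h2.1, mul_inv_cancel_left₀ hρ.ne']
  have hpR : 1 < p.toReal := by
    have := (ENNReal.toReal_lt_toReal (by norm_num) hp).2 hp1
    simpa using this
  have hlim : Tendsto (fun N : ℕ => (2 * σ)⁻¹ * (N : ℝ) ^ (-(1 - 1 / p.toReal))) atTop (𝓝 0) := by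
    have h1 : 0 < 1 - 1 / p.toReal := by
      rw [sub_pos, div_lt_one (by linarith)]; exact hpR
    simpa using ((tendsto_rpow_neg_atTop h1).comp tendsto_natCast_atTop_atTop).const_mul (2 * σ)⁻¹
  have hδ2 : 0 < S.δ / 2 := half_pos S.δ_pos
  obtain ⟨N₀, hN₀⟩ := eventually_atTop.1 (hlim.eventually_lt_const hδ2)
  obtain ⟨N, r, hN, hN1, hr, B', hBm, ⟨β', hβ'⟩, hB', hfc⟩ :=
    H ψ hψm hψ1 S.B S.measurable_B S.β S.abs_B_le (S.δ / 2) hδ2 N₀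
  have hN0 : (0 : ℝ) < N := by exact_mod_cast hN1
  set f : ℤ →₀ ℂ := S.coeff - (ρ : ℂ) • cosAvgCoeff σ N r
  have hf0 : f 0 = 1 := by
    simp [f, S.coeff_zero, cosAvgCoeff_zero σ N hr]
  obtain ⟨δ, hδ, hδ', hsub⟩ := exists_closedBall_subset hp1 hp hf0 (n + 1) hδ2
  have hnorm : ∀ (p' : ENNReal) [Fact (1 ≤ p')], p' ≠ ⊤ → ‖emb p' f - emb p' S.coeff‖ ≤
      ρ * ((2 * σ * N)⁻¹ * (N : ℝ) ^ (1 / p'.toReal)) := by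
    intro p' _ hp'
    simp only [f, map_sub, map_smul]
    rw [sub_sub_cancel_left, norm_neg, norm_smul, Complex.norm_real, Real.norm_eq_abs,
      abs_of_pos hρ]
    exact mul_le_mul_of_nonneg_left (norm_emb_cosAvgCoeff_le hp' hσ N hr) hρ.le
  refine ⟨{
    coeff := f
    poly := fun t => S.poly t - ρ * cosAvg σ N r t
    B := B'
    β := β'
    δ := δ
    coeff_zero := hf0
    trigPoly_coeff := fun t => ?_
    measurable_poly := S.measurable_poly.sub ((continuous_cosAvg σ N r).measurable.const_mul _)
    measurable_B := hBm
    abs_B_le := hβ'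
    poly_le := fun t ht => ?_
    δ_pos := hδ
    closedBall_subset := hsub }, hδ', ?_, ?_, hfc⟩
  · have h1 := S.trigPoly_coeff t
    have h2 := trigPoly_cosAvgCoeff σ N r t
    simp only [trigPoly] at h1 h2 ⊢
    simp only [f, map_sub, map_smul, h1, h2]
    push_cast
    rfl
  · obtain ⟨h1, h2⟩ := hB' t ht
    rw [← hψ t h1, ← mul_sub, abs_mul, abs_of_pos hρ, pow_succ]
    exact mul_le_mul_of_nonneg_left h2 hρ.le
  · refine (hnorm 1 (by simp)).trans_eq ?_
    simp only [ENNReal.toReal_one, div_one, Real.rpow_one, mul_inv]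
    field_simp
  · refine (hnorm p hp).trans ?_
    have h1 : (N : ℝ) ^ (-(1 - 1 / p.toReal)) = (N : ℝ)⁻¹ * (N : ℝ) ^ (1 / p.toReal) := by
      rw [neg_sub, Real.rpow_sub hN0, Real.rpow_one, div_eq_inv_mul]
    have h2 := (hN₀ N hN).le
    rw [h1] at h2
    have h3 : (2 * σ * N)⁻¹ * (N : ℝ) ^ (1 / p.toReal) =
      (2 * σ)⁻¹ * ((N : ℝ)⁻¹ * (N : ℝ) ^ (1 / p.toReal)) := by rw [mul_inv, mul_assoc]
    rw [h3]
    exact (mul_le_of_le_one_left (by positivity) hρ1).trans h2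

/-- A cyclic vector `x` of `ℓᵖ` that is summable, and an element `b` of the dual `ℓ^q` that is a
limit of functions carried by sets on which the transform of `x` tends to zero uniformly. -/
theorem exists_cyclic_and_functional [Fact (1 ≤ q)] (hp1 : 1 < p) (hp : p ≠ ⊤) (hq2 : 2 < q)
    (hq : q ≠ ⊤) :
    ∃ (x : Seq 1) (x' : Seq p) (b : Seq q) (B : ℕ → Circ → ℝ) (C : ℝ),
      (∀ k, x' k = x k) ∧ (translates x').topologicalClosure = ⊤ ∧
      (∀ n, MemLp (fun t => (B n t : ℂ)) 2 haar) ∧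
      (∀ n t, B n t ≠ 0 → ‖hat x t‖ ≤ C * (15 / 16) ^ n) ∧
      Tendsto (fun n => fc q (fun t => (B n t : ℂ))) atTop (𝓝 b) ∧ b 0 ≠ 0 := by
  obtain ⟨σ, hσ, -, H⟩ := exists_modification hq hq2
  choose next hnext using fun n S => exists_approximant_succ (q := q) hp1 hp hσ H n S
  obtain ⟨S₀, hS₀, hS₀'⟩ := exists_approximant_zero hp1 hp
  set S : ∀ n, Approximant p n := fun n => Nat.rec S₀ next n
  have hS : ∀ n, S (n + 1) = next n (S n) := fun n => rfl
  have hδ : ∀ n, (S (n + 1)).δ ≤ (S n).δ / 2 := fun n => (hnext n (S n)).1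
  obtain ⟨x', hx't, hx'⟩ := exists_tendsto_dist_le (u := fun n => emb p (S n).coeff)
    (δ := fun n => (S n).δ)
    (fun n => by rw [dist_comm, dist_eq_norm]; exact (hnext n (S n)).2.2.1) hδ
  obtain ⟨b, hbt, hb⟩ := exists_tendsto_dist_le (u := fun n => fc q fun t => ((S n).B t : ℂ))
    (δ := fun n => (S n).δ)
    (fun n => by rw [dist_comm, dist_eq_norm]; exact (hnext n (S n)).2.2.2) hδ
  have hd1 : ∀ n, dist (emb 1 (S n).coeff) (emb 1 (S (n + 1)).coeff) ≤
      (2 * σ)⁻¹ * (15 / 16) ^ n := fun n => by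
    rw [dist_comm, dist_eq_norm]; exact (hnext n (S n)).2.1
  obtain ⟨x, hxt⟩ := cauchySeq_tendsto_of_complete
    (cauchySeq_of_le_geometric (15 / 16) (2 * σ)⁻¹ (by norm_num) hd1)
  have hx : ∀ n, dist (emb 1 (S n).coeff) x ≤ (2 * σ)⁻¹ * (15 / 16) ^ n / (1 - 15 / 16) :=
    dist_le_of_le_geometric_of_tendsto (15 / 16) (2 * σ)⁻¹ (by norm_num) hd1 hxt
  refine ⟨x, x', b, fun n => (S n).B, 16 * (2 * σ)⁻¹ + 1, fun k => ?_, ?_, fun n => ?_, ?_, hbt, ?_⟩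
  · have h1 := ((lp.evalCLM ℂ (fun _ : ℤ => ℂ) p k).continuous.tendsto _).comp hx't
    have h2 := ((lp.evalCLM ℂ (fun _ : ℤ => ℂ) 1 k).continuous.tendsto _).comp hxt
    refine tendsto_nhds_unique h1 (h2.congr fun n => ?_)
    change emb 1 (S n).coeff k = emb p (S n).coeff k
    simp
  · exact topologicalClosure_translates_of_nearCyclic hp x' fun n =>
      (S n).closedBall_subset (hx' n)
  · refine memLp_of_bound (β := (S n).β) (measurable_ofReal.comp (S n).measurable_B) fun t => ?_
    rw [Complex.norm_real]
    exact (S n).abs_B_le t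
  · intro n t ht
    have h1 : ‖hat (emb 1 (S n).coeff) t‖ ≤ (15 / 16) ^ n := by
      rw [hat_emb, (S n).trigPoly_coeff, Complex.norm_real]
      exact (S n).poly_le t ht
    have h2 : ‖hat (x - emb 1 (S n).coeff) t‖ ≤ (2 * σ)⁻¹ * (15 / 16) ^ n / (1 - 15 / 16) := by
      refine (norm_hat_le _ t).trans ?_
      rw [← dist_eq_norm, dist_comm]
      exact hx n
    rw [hat_sub] at h2
    have h3 := norm_add_le (hat x t - hat (emb 1 (S n).coeff) t) (hat (emb 1 (S n).coeff) t)
    rw [sub_add_cancel] at h3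
    calc ‖hat x t‖ ≤ (2 * σ)⁻¹ * (15 / 16) ^ n / (1 - 15 / 16) + (15 / 16) ^ n :=
          h3.trans (add_le_add h2 h1)
      _ = _ := by ring
  · intro h0
    have h1 := hb 0
    rw [dist_eq_norm] at h1
    have h2 := lp.norm_apply_le_norm (lt_of_lt_of_le one_pos (Fact.out : 1 ≤ q)).ne'
      (b - fc q fun t => ((S 0).B t : ℂ)) 0
    have h3 : fc q (fun t => ((S 0).B t : ℂ)) 0 = 1 := by
      have hB : (fun t => ((S 0).B t : ℂ)) = fun _ => 1 := by
        funext t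
        have : (S 0).B t = 1 := hS₀' t
        rw [this, Complex.ofReal_one]
      rw [hB, fc_apply (memLp_const 1), fourierCoeff]
      simp
    rw [lp.coeFn_sub, Pi.sub_apply, h0, h3] at h2
    have h4 : (S 0).δ ≤ 1 / 2 := hS₀
    norm_num at h2
    linarith

end

/-- The inclusion of `ℓ¹` into `ℓ^p`. -/
noncomputable def incl (p : ENNReal) [hp : Fact (1 ≤ p)] (hp' : p ≠ ⊤) : Seq 1 →L[ℂ] Seq p :=
  (lp.linearMapOfLE ℂ (fun _ : ℤ => ℂ) hp.out).mkContinuous 1 fun v => by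
    rw [one_mul]
    exact norm_le_of_le_exponent hp.out hp' v _ fun k => by rw [lp.coe_linearMapOfLE_apply]

theorem incl_apply (p : ENNReal) [hp : Fact (1 ≤ p)] (hp' : p ≠ ⊤) (v : Seq 1) (k : ℤ) :
    incl p hp' v k = v k := by
  rw [incl, LinearMap.mkContinuous_apply, lp.coe_linearMapOfLE_apply]

theorem incl_shift {p : ENNReal} [hp : Fact (1 ≤ p)] (hp' : p ≠ ⊤) (m : ℤ) (v : Seq 1) :
    incl p hp' (shift 1 m v) = shift p m (incl p hp' v) := by
  ext k
  rw [incl_apply, shift_apply, shift_apply, incl_apply]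

theorem hat_shift (m : ℤ) (v : Seq 1) (t : Circ) : hat (shift 1 m v) t = fourier m t * hat v t := by
  rw [hat, hat, ← tsum_mul_left, ← (Equiv.addRight m).tsum_eq]
  refine tsum_congr fun k => ?_
  rw [shift_apply, Equiv.coe_addRight, add_sub_cancel_right, fourier_add]
  ring

/-- Evaluation of `hat` at a point, as a continuous functional on `ℓ¹`. -/
noncomputable def hatCLM (t : Circ) : Seq 1 →L[ℂ] ℂ :=
  LinearMap.mkContinuous
    { toFun := fun v => hat v t
      map_add' := fun v w => by
        rw [hat, hat, hat, ← (summable_hat v t).tsum_add (summable_hat w t)]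
        simp [add_mul]
      map_smul' := fun c v => by
        simp only [hat, lp.coeFn_smul, Pi.smul_apply, smul_eq_mul, mul_assoc, tsum_mul_left,
          RingHom.id_apply] }
    1 fun v => by
      rw [one_mul]
      exact norm_hat_le v t

theorem hatCLM_apply (t : Circ) (v : Seq 1) : hatCLM t v = hat v t := rfl

section
variable {p q : ENNReal} [Fact (1 ≤ p)] [Fact (1 ≤ q)] [q.HolderConjugate p]

/-- The duality pairing `v ↦ ∑ conj (b m) v m` between `ℓ^q` and `ℓ^p`. -/
noncomputable def pairing (b : Seq q) : Seq p →L[ℂ] ℂ :=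
  lp.dualPairing q p (fun _ : ℤ => ContinuousLinearMap.mul ℂ ℂ) (K := 1)
    (fun _ => by simp) (star b)

theorem pairing_apply (b : Seq q) (v : Seq p) : pairing b v = ∑' m, star (b m) * v m := by
  exact lp.dualPairing_apply _ _ _ _

theorem tendsto_pairing {b : ℕ → Seq q} {b' : Seq q} (h : Tendsto b atTop (𝓝 b')) (v : Seq p) :
    Tendsto (fun n => pairing (b n) v) atTop (𝓝 (pairing b' v)) := by
  have h1 : Continuous fun b : Seq q => (pairing b : Seq p →L[ℂ] ℂ) v := by
    unfold pairing
    fun_prop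
  exact (h1.tendsto b').comp h

theorem pairing_e (b : Seq q) (k : ℤ) : pairing b (e p k) = star (b k) := by
  rw [pairing_apply, tsum_eq_single k]
  · simp [e_apply]
  · intro m hm
    simp [e_apply, hm]

theorem pairing_fc_incl [Fact (2 ≤ q)] (hp : p ≠ ⊤) {B : Circ → ℝ}
    (hB : MemLp (fun t => (B t : ℂ)) 2 haar) (v : Seq 1) :
    pairing (fc q fun t => (B t : ℂ)) (incl p hp v) = ∫ t, B t * hat v t ∂haar := by
  have hBi : Integrable (fun t => (B t : ℂ)) haar := hB.integrable one_le_two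
  have hInt : ∀ k : ℤ, Integrable (fun t => (B t : ℂ) * (v k * fourier k t)) haar := by
    intro k
    refine hBi.mul_bdd (c := ‖v k‖) (by fun_prop) (ae_of_all _ fun t => ?_)
    rw [norm_mul, norm_fourier_apply, mul_one]
  have hnorm : ∀ k : ℤ, ∫ t, ‖(B t : ℂ) * (v k * fourier k t)‖ ∂haar =
      (∫ t, ‖(B t : ℂ)‖ ∂haar) * ‖v k‖ := by
    intro k
    rw [← integral_mul_const]
    refine integral_congr_ae (ae_of_all _ fun t => ?_)
    simp only [norm_mul, norm_fourier_apply, mul_one]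
  have h := hasSum_integral_of_summable_integral_norm hInt (by
    simp only [hnorm]
    exact (summable_norm_seq v).mul_left _)
  rw [pairing_apply]
  simp only [hat, ← tsum_mul_left]
  rw [← h.tsum_eq]
  refine tsum_congr fun k => ?_
  rw [fc_apply hB, incl_apply, fourierCoeff, Complex.star_def, ← integral_conj, ← integral_mul_const]
  refine integral_congr_ae (ae_of_all _ fun t => ?_)
  simp only [smul_eq_mul, map_mul, Complex.conj_ofReal, fourier_neg, Complex.conj_conj]
  ring

theorem pairing_incl_eq_zero [Fact (2 ≤ q)] (hp : p ≠ ⊤) {B : ℕ → Circ → ℝ}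
    (hB : ∀ n, MemLp (fun t => (B n t : ℂ)) 2 haar) {x v : Seq 1} {C κ : ℝ}
    (hx : ∀ n t, B n t ≠ 0 → ‖hat x t‖ ≤ C * (15 / 16) ^ n) (hκ : 0 < κ)
    (hv : ∀ t, hat v t ≠ 0 → κ ≤ ‖hat x t‖) {b : Seq q}
    (hb : Tendsto (fun n => fc q (fun t => (B n t : ℂ))) atTop (𝓝 b)) :
    pairing b (incl p hp v) = 0 := by
  have h0 : Tendsto (fun n : ℕ => C * (15 / 16 : ℝ) ^ n) atTop (𝓝 (C * 0)) :=
    (tendsto_pow_atTop_nhds_zero_of_lt_one (by norm_num) (by norm_num)).const_mul C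
  rw [mul_zero] at h0
  refine tendsto_nhds_unique (tendsto_pairing hb _) (tendsto_const_nhds.congr' ?_)
  filter_upwards [h0.eventually_lt_const hκ] with n hn
  rw [pairing_fc_incl hp (hB n)]
  refine (integral_eq_zero_of_ae (ae_of_all _ fun t => ?_)).symm
  simp only [Pi.zero_apply, mul_eq_zero, Complex.ofReal_eq_zero]
  by_contra! h
  linarith [hx n t h.1, hv t h.2]

end

/-- The indicator function of the ball of radius `ε` around `0`. -/
noncomputable def ballIndicator (ε : ℝ) (t : Circ) : ℂ :=
  (Metric.ball (0 : Circ) ε).indicator (fun _ => 1) t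

theorem memLp_ballIndicator (ε : ℝ) (a : Circ) :
    MemLp (fun t => ballIndicator ε (t + a)) 2 haar := by
  refine memLp_of_bound (β := 1) ?_ fun t => ?_
  · exact (measurable_const.indicator Metric.isOpen_ball.measurableSet).comp (measurable_add_const a)
  · rw [ballIndicator]
    refine (norm_indicator_le_norm_self _ _).trans ?_
    simp

theorem fourierCoeff_translate (f : Circ → ℂ) (a : Circ) (k : ℤ) :
    fourierCoeff (fun t => f (t + a)) k = fourier k a * fourierCoeff f k := by
  rw [fourierCoeff, fourierCoeff,
    ← integral_add_right_eq_self (fun t => (fourier (-k) t : ℂ) • f t) a, ← integral_const_mul]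
  refine integral_congr_ae (ae_of_all _ fun t => ?_)
  have h : (fourier k a : ℂ) * fourier (-k) a = 1 := by
    rw [← fourier_add, add_neg_cancel, fourier_zero]
  have h2 : (fourier (-k) (t + a) : ℂ) = fourier (-k) t * fourier (-k) a := by
    simp only [fourier_apply, smul_add, AddCircle.toCircle_add, Circle.coe_mul]
  simp only [smul_eq_mul, h2]
  linear_combination (-(fourier (-k) t : ℂ) * f (t + a)) * h

theorem hasSum_correlation {f g : Circ → ℂ} (hf : MemLp f 2 haar) (hg : MemLp g 2 haar) :
    HasSum (fun k => star (fourierCoeff f k) * fourierCoeff g k) (∫ t, star (f t) * g t ∂haar) := by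
  have h := fourierBasis.hasSum_inner_mul_inner (hf.toLp f) (hg.toLp g)
  have h1 : ∀ (u : Circ → ℂ) (hu : MemLp u 2 haar) (k : ℤ),
      inner ℂ (fourierBasis k) (hu.toLp u) = fourierCoeff u k := by
    intro u hu k
    rw [← HilbertBasis.repr_apply_apply, fourierBasis_repr]
    exact congrFun (fourierCoeff_congr_ae (MemLp.coeFn_toLp hu)) k
  rw [L2.inner_def] at h
  convert! h using 1
  · ext k
    rw [h1, ← inner_conj_symm, h1]
    rfl
  · refine integral_congr_ae ?_
    filter_upwards [hf.coeFn_toLp, hg.coeFn_toLp] with t h2 h3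
    rw [h2, h3, RCLike.inner_apply, mul_comm]
    rfl

theorem memℓp_bump (a : Circ) (ε : ℝ) :
    Memℓp (fun k : ℤ => (‖fourierCoeff (ballIndicator ε) k‖ : ℂ) ^ 2 * fourier (-k) a) 1 := by
  have h : MemLp (ballIndicator ε) 2 haar := by simpa using memLp_ballIndicator ε 0
  refine memℓp_gen ?_
  have := (hasSum_correlation h h).summable.norm
  convert! this using 2 with k
  rw [norm_mul, norm_mul, norm_fourier_apply]
  simp [sq]

/-- An absolutely summable sequence whose Fourier series is a bump around `a` of width `ε`. -/
noncomputable def bump (a : Circ) (ε : ℝ) : Seq 1 := ⟨_, memℓp_bump a ε⟩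

theorem hat_bump (a : Circ) (ε : ℝ) (t : Circ) :
    hat (bump a ε) t =
      (haar.real (Metric.ball 0 ε ∩ (fun s => s + (t - a)) ⁻¹' Metric.ball 0 ε) : ℂ) := by
  have h : MemLp (ballIndicator ε) 2 haar := by simpa using memLp_ballIndicator ε 0
  have h1 := (hasSum_correlation h (memLp_ballIndicator ε (t - a))).tsum_eq
  have h2 : ∫ s, star (ballIndicator ε s) * ballIndicator ε (s + (t - a)) ∂haar =
      (haar.real (Metric.ball 0 ε ∩ (fun s => s + (t - a)) ⁻¹' Metric.ball 0 ε) : ℂ) := by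
    have hm : MeasurableSet (Metric.ball (0 : Circ) ε ∩
        (fun s => s + (t - a)) ⁻¹' Metric.ball 0 ε) :=
      Metric.isOpen_ball.measurableSet.inter
        (measurable_add_const (t - a) Metric.isOpen_ball.measurableSet)
    have := integral_indicator_const (μ := haar) (1 : ℂ) hm
    rw [Complex.real_smul, mul_one] at this
    rw [← this]
    refine integral_congr_ae (ae_of_all _ fun s => ?_)
    have hmul := Set.inter_indicator_mul (s := Metric.ball (0 : Circ) ε)
      (t := (fun s => s + (t - a)) ⁻¹' Metric.ball 0 ε) (fun _ => (1 : ℂ)) (fun _ => 1) s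
    rw [mul_one] at hmul
    refine Eq.trans (congrArg (· * _) ?_) hmul.symm
    by_cases hs : s ∈ Metric.ball (0 : Circ) ε
    · rw [ballIndicator, Set.indicator_of_mem hs, star_one]
    · rw [ballIndicator, Set.indicator_of_notMem hs, star_zero]
  rw [← h2, ← h1, hat]
  refine tsum_congr fun k => ?_
  change ((‖fourierCoeff (ballIndicator ε) k‖ : ℂ) ^ 2 * fourier (-k) a) * fourier k t = _
  have h3 : (fourier k (t - a) : ℂ) = fourier (-k) a * fourier k t := by
    rw [sub_eq_add_neg, fourier_apply, smul_add, AddCircle.toCircle_add, Circle.coe_mul,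
      fourier_apply, fourier_apply, smul_neg, neg_smul, mul_comm]
  rw [fourierCoeff_translate, h3, ← Complex.mul_conj', Complex.star_def]
  ring

theorem dist_lt_of_hat_bump_ne_zero {a t : Circ} {ε : ℝ} (h : hat (bump a ε) t ≠ 0) :
    dist t a < 2 * ε := by
  rw [hat_bump] at h
  by_contra! hd
  refine h ?_
  rw [Complex.ofReal_eq_zero, measureReal_def]
  convert ENNReal.toReal_zero
  convert measure_empty (μ := haar)
  ext s
  simp only [Set.mem_inter_iff, Set.mem_preimage, mem_ball_zero_iff, Set.mem_empty_iff_false,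
    iff_false, not_and]
  intro h1 h2
  rw [dist_eq_norm] at hd
  have := norm_sub_le (s + (t - a)) s
  rw [add_sub_cancel_left] at this
  linarith

theorem hat_bump_pos {a t : Circ} {ε : ℝ} (hd : dist t a < ε) :
    0 < haar.real (Metric.ball 0 ε ∩ (fun s => s + (t - a)) ⁻¹' Metric.ball 0 ε) := by
  refine ENNReal.toReal_pos (ne_of_gt ?_) (measure_ne_top _ _)
  refine (Metric.isOpen_ball.inter (Metric.isOpen_ball.preimage (by fun_prop))).measure_pos _ ?_
  have := dist_nonneg.trans_lt hd
  exact ⟨0, by simp [hd, this]⟩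

/-- The Fourier series of `v` is supported where that of `x` is bounded away from `0`. -/
def SupportedAway (x v : Seq 1) : Prop :=
  ∃ κ : ℝ, 0 < κ ∧ ∀ t, hat v t ≠ 0 → κ ≤ ‖hat x t‖

theorem exists_supportedAway_bump {x : Seq 1} {t : Circ} (ht : hat x t ≠ 0) :
    ∃ i n : ℕ, SupportedAway x (bump (TopologicalSpace.denseSeq Circ i) (1 / (n + 1))) ∧
      dist t (TopologicalSpace.denseSeq Circ i) < 1 / (n + 1) := by
  have hx : 0 < ‖hat x t‖ := norm_pos_iff.2 ht
  have h1 : ∀ᶠ s in 𝓝 t, ‖hat x t‖ / 2 < ‖hat x s‖ :=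
    (continuous_hat x).norm.continuousAt.eventually_const_lt (by linarith)
  obtain ⟨η, hη, h2⟩ := Metric.eventually_nhds_iff.1 h1
  obtain ⟨n, hn⟩ := exists_nat_one_div_lt (show 0 < η / 3 by positivity)
  have hn0 : (0 : ℝ) < 1 / (n + 1) := by positivity
  obtain ⟨i, hi⟩ := (TopologicalSpace.denseRange_denseSeq Circ).exists_dist_lt t hn0
  refine ⟨i, n, ⟨‖hat x t‖ / 2, by positivity, fun s hs => (h2 ?_).le⟩, hi⟩
  have h3 := dist_lt_of_hat_bump_ne_zero hs
  have h4 := dist_triangle_right s t (TopologicalSpace.denseSeq Circ i)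
  linarith

theorem exists_same_zeros (x : Seq 1) :
    ∃ y : Seq 1, (∀ t, hat y t = 0 ↔ hat x t = 0) ∧
      ∀ L : Seq 1 →L[ℂ] ℂ, (∀ v, SupportedAway x v → L v = 0) → L y = 0 := by
  classical
  let u : ℕ × ℕ → Seq 1 := fun j => bump (TopologicalSpace.denseSeq Circ j.1) (1 / (j.2 + 1))
  let c : ℕ × ℕ → ℝ := fun j =>
    if SupportedAway x (u j) then (1 / 2) ^ Encodable.encode j / (1 + ‖u j‖) else 0
  have hu : ∀ j t, ∃ r : ℝ, 0 ≤ r ∧ hat (u j) t = r := fun j t =>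
    ⟨_, measureReal_nonneg, hat_bump _ _ _⟩
  have hc0 : ∀ j, 0 ≤ c j := fun j => by
    simp only [c]
    split_ifs <;> positivity
  have hsum : Summable fun j => (c j : ℂ) • u j := by
    refine Summable.of_norm_bounded (g := fun j => (1 / 2 : ℝ) ^ Encodable.encode j)
      summable_geometric_two_encode fun j => ?_
    rw [norm_smul, Complex.norm_real, Real.norm_of_nonneg (hc0 j)]
    simp only [c]
    split_ifs
    · have h1 : 0 < 1 + ‖u j‖ := by positivity
      rw [div_mul_eq_mul_div, div_le_iff₀ h1]
      gcongr
      linarith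
    · rw [zero_mul]
      positivity
  have hL : ∀ L : Seq 1 →L[ℂ] ℂ, HasSum (fun j => (c j : ℂ) * L (u j))
      (L (∑' j, (c j : ℂ) • u j)) :=
    fun L => by simpa only [Function.comp_def, map_smul, smul_eq_mul] using hsum.hasSum.mapL L
  have hzero : ∀ L : Seq 1 →L[ℂ] ℂ, (∀ v, SupportedAway x v → L v = 0) →
      L (∑' j, (c j : ℂ) • u j) = 0 := by
    intro L hL0
    refine (hL L).unique ?_
    convert! hasSum_zero with j
    by_cases hj : SupportedAway x (u j)
    · rw [hL0 _ hj, mul_zero]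
    · simp [c, hj]
  refine ⟨∑' j, (c j : ℂ) • u j, fun t => ⟨fun hy => ?_, fun hx => ?_⟩, hzero⟩
  · by_contra hx
    obtain ⟨i, n, hs, hd⟩ := exists_supportedAway_bump hx
    choose r hr0 hr using fun j => hu j t
    have h1 := hL (hatCLM t)
    rw [hatCLM_apply, hy] at h1
    have h2 : HasSum (fun j => c j * r j) 0 := by
      rw [← Complex.hasSum_ofReal]
      simpa only [hatCLM_apply, hr, Complex.ofReal_mul, Complex.ofReal_zero] using h1
    have h3 := (hasSum_zero_iff_of_nonneg fun j => mul_nonneg (hc0 j) (hr0 j)).1 h2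
    have h4 := congrFun h3 (i, n)
    have h5 : 0 < c (i, n) := by
      simp only [c, u, if_pos hs]
      positivity
    have h6 : 0 < r (i, n) := by
      have h7 := (hr (i, n)).symm.trans (hat_bump _ _ _)
      rw [Complex.ofReal_inj.1 h7]
      exact hat_bump_pos hd
    exact (mul_pos h5 h6).ne' h4
  · refine hzero (hatCLM t) fun v ⟨κ, hκ, hv⟩ => ?_
    by_contra h
    have := hv t h
    rw [hx, norm_zero] at this
    linarith

theorem tsum_exp_eq_hat (v : Seq 1) (t : ℝ) :
    ∑' k : ℤ, (v : ℤ → ℂ) k * Complex.exp (Complex.I * k * t) = hat v (t : Circ) := by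
  rw [hat]
  refine tsum_congr fun k => ?_
  rw [fourier_coe_apply]
  congr 2
  have : (Real.pi : ℂ) ≠ 0 := by exact_mod_cast Real.pi_ne_zero
  push_cast
  field_simp

theorem isCyclicVector_iff {p : ENNReal} [Fact (1 ≤ p)] (x : ℤ → ℂ) (v : Seq p)
    (h : ∀ k, v k = x k) :
    IsCyclicVector p x ↔ (translates v).topologicalClosure = ⊤ := by
  rw [IsCyclicVector, span_translates_eq x v h, Submodule.dense_iff_topologicalClosure_eq_top]

theorem translates_topologicalClosure_ne_top {p : ENNReal} [Fact (1 ≤ p)] {v : Seq p}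
    (L : Seq p →L[ℂ] ℂ) (hL : L ≠ 0) (h : ∀ m, L (shift p m v) = 0) :
    (translates v).topologicalClosure ≠ ⊤ := by
  intro htop
  have h1 : translates v ≤ LinearMap.ker L.toLinearMap := by
    refine Submodule.span_le.2 ?_
    rintro _ ⟨m, rfl⟩
    exact h m
  have h2 := Submodule.topologicalClosure_minimal _ h1 L.isClosed_ker
  rw [htop] at h2
  exact hL (ContinuousLinearMap.ext fun w => h2 (Submodule.mem_top (x := w)))

theorem conjExponent_ne_top {p : ENNReal} (hp1 : 1 < p) : p.conjExponent ≠ ⊤ := by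
  rw [ENNReal.conjExponent]
  exact ENNReal.add_ne_top.2 ⟨ENNReal.one_ne_top, ENNReal.inv_ne_top.2 (tsub_pos_of_lt hp1).ne'⟩

theorem two_lt_conjExponent {p : ENNReal} (hp1 : 1 < p) (hp2 : p < 2) : 2 < p.conjExponent := by
  rw [ENNReal.conjExponent, ← one_add_one_eq_two]
  refine ENNReal.add_lt_add_left ENNReal.one_ne_top (ENNReal.one_lt_inv.2 ?_)
  exact ENNReal.sub_lt_of_lt_add hp1.le (by rwa [one_add_one_eq_two])

end LevOlevskii

open LevOlevskii

/-- The Lev–Olevskii theorem disproving Wiener's conjecture: for every `1 < p < 2`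
there exist `x, y ∈ ℓ¹(ℤ)` whose Fourier transforms have the same zero set on the
circle, yet `x` is cyclic in `ℓᵖ(ℤ)` and `y` is not. -/
theorem lev_olevskii (p : ENNReal) [Fact (1 ≤ p)] (hp1 : 1 < p) (hp2 : p < 2) :
    ∃ x y : lp (fun _ : ℤ => ℂ) 1,
      {t : ℝ | (∑' k : ℤ, (x : ℤ → ℂ) k * Complex.exp (Complex.I * k * t)) = 0} =
        {t : ℝ | (∑' k : ℤ, (y : ℤ → ℂ) k * Complex.exp (Complex.I * k * t)) = 0} ∧
      IsCyclicVector p (x : ℤ → ℂ) ∧ ¬ IsCyclicVector p (y : ℤ → ℂ) := by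
  have h2q : Fact (2 ≤ p.conjExponent) := ⟨(two_lt_conjExponent hp1 hp2).le⟩
  have : Fact (1 ≤ p.conjExponent) := ⟨one_le_two.trans h2q.out⟩
  have : p.conjExponent.HolderConjugate p := ENNReal.HolderConjugate.symm
  have hp : p ≠ ⊤ := (hp2.trans ENNReal.ofNat_lt_top).ne
  obtain ⟨x, x', b, B, C, hx', hcyc, hB, hBx, hb, hb0⟩ :=
    exists_cyclic_and_functional (p := p) (q := p.conjExponent) hp1 hp
      (two_lt_conjExponent hp1 hp2) (conjExponent_ne_top hp1)
  obtain ⟨y, hzero, hy⟩ := exists_same_zeros x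
  refine ⟨x, y, ?_, (isCyclicVector_iff _ x' hx').2 hcyc, ?_⟩
  · ext t
    simp only [Set.mem_ofPred_eq, tsum_exp_eq_hat, hzero]
  · rw [isCyclicVector_iff _ (incl p hp y) (incl_apply p hp y)]
    refine translates_topologicalClosure_ne_top (pairing b) (fun h => hb0 ?_) fun m => ?_
    · rw [← star_eq_zero, ← pairing_e (p := p), h, _root_.zero_apply]
    · rw [← incl_shift]
      refine hy ((pairing b).comp ((incl p hp).comp (shift 1 m))) fun v ⟨κ, hκ, hv⟩ => ?_
      refine pairing_incl_eq_zero hp hB hBx hκ (fun t ht => hv t fun h => ht ?_) hb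
      exact (hat_shift m v t).trans (by rw [h, mul_zero])
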